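/- Let A be a finite alphabet, D = {1,…,n} × {1,…,m}, and let P ⊆ A^D be a set of D-patterns with |P| ≤ nm. Let X = { c ∈ A^{ℤ²} : Patt(c,D) ⊆ P } be the set of configurations all of whose D-patterns belong to P. If X is non-empty, then X contains a periodic configuration. -/

import Mathlib

/-- Translation of a configuration by `t`: `(Translate t c) n = c (n - t)`. -/
def Translate {A : Type*} (t : ℤ × ℤ) (c : ℤ × ℤ → A) : ℤ × ℤ → A :=
  fun n => c (n - t)

/-- The orbit of a configuration: the set of all its translates. -/
def orbit {A : Type*} (c : ℤ × ℤ → A) : Set (ℤ × ℤ → A) :=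
  { d | ∃ t : ℤ × ℤ, d = Translate t c }

/-- The orbit closure: the topological closure of the orbit (in the product
topology of the discrete topology on the alphabet). -/
def orbitClosure {A : Type*} [TopologicalSpace A] (c : ℤ × ℤ → A) : Set (ℤ × ℤ → A) :=
  closure (orbit c)

/-- The standard inner product on `ℤ²`. -/
def inner2 (x u : ℤ × ℤ) : ℤ := x.1 * u.1 + x.2 * u.2

/-- The discrete half plane in direction `u`. -/
def halfPlane (u : ℤ × ℤ) : Set (ℤ × ℤ) := { x | inner2 x u < 0 }

/-- A set of configurations is deterministic in direction `u`: the contents of a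
configuration on the half plane `H_u` determine the whole configuration. -/
def DeterministicIn {A : Type*} (X : Set (ℤ × ℤ → A)) (u : ℤ × ℤ) : Prop :=
  ∀ d ∈ X, ∀ e ∈ X, Set.EqOn d e (halfPlane u) → d = e

/-- The set of `D`-patterns appearing in `c` : restrictions of translates of `c` to `D`. -/
def patterns {A : Type*} (c : ℤ × ℤ → A) (D : Set (ℤ × ℤ)) : Set (D → A) :=
  { p | ∃ t : ℤ × ℤ, ∀ x : D, p x = Translate t c x }

/-- A configuration is periodic if it is fixed by some non-trivial translation. -/
def Periodic {A : Type*} (c : ℤ × ℤ → A) : Prop :=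
  ∃ t : ℤ × ℤ, t ≠ 0 ∧ Translate t c = c

/-- The discrete rectangle `{1,…,n} × {1,…,m}`. -/
def rect (n m : ℕ) : Set (ℤ × ℤ) :=
  { x | 1 ≤ x.1 ∧ x.1 ≤ (n : ℤ) ∧ 1 ≤ x.2 ∧ x.2 ≤ (m : ℤ) }

namespace LowComplexity

open Polynomial Filter Topology

section Sequences

/-- The shift operator on bi-infinite complex sequences. -/
def seqShift : Module.End ℂ (ℤ → ℂ) where
  toFun r x := r (x + 1)
  map_add' _ _ := rfl
  map_smul' _ _ := rfl

theorem seqShift_pow_apply (k : ℕ) (r : ℤ → ℂ) (x : ℤ) :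
    (seqShift ^ k) r x = r (x + k) := by
  induction k generalizing x with
  | zero => simp
  | succ k ih =>
    rw [pow_succ', Module.End.mul_apply]
    change (seqShift ^ k) r (x + 1) = _
    rw [ih]
    push_cast
    congr 1
    ring

theorem aeval_seqShift_apply (q : ℂ[X]) (r : ℤ → ℂ) (x : ℤ) :
    aeval seqShift q r x =
      ∑ i ∈ Finset.range (q.natDegree + 1), q.coeff i * r (x + i) := by
  rw [aeval_eq_sum_range]
  simp [LinearMap.sum_apply, Finset.sum_apply, seqShift_pow_apply]

theorem eq_zero_of_aeval_seqShift_eq_zero {q : ℂ[X]} (hq : q ≠ 0) {r : ℤ → ℂ}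
    (hr : aeval seqShift q r = 0) (x₀ : ℤ)
    (h0 : ∀ i : ℕ, i < q.natDegree → r (x₀ + i) = 0) : r = 0 := by
  have hsum (x : ℤ) := (aeval_seqShift_apply q r x).symm.trans (congrFun hr x)
  have up (n : ℕ) : r (x₀ + n) = 0 := by
    induction n using Nat.strong_induction_on with
    | _ n ih =>
      rcases lt_or_ge n q.natDegree with h | h
      · exact h0 n h
      · have h1 := hsum (x₀ + n - q.natDegree)
        rw [Finset.sum_range_succ, Finset.sum_eq_zero, zero_add] at h1
        · rw [sub_add_cancel] at h1
          simpa [hq] using h1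
        · intro i hi
          have hi := Finset.mem_range.1 hi
          have h2 := ih (n - q.natDegree + i) (by omega)
          rw [show x₀ + n - q.natDegree + i = x₀ + ((n - q.natDegree + i : ℕ) : ℤ) by
            push_cast [h]; ring, h2, mul_zero]
  have down (n : ℕ) : r (x₀ - n) = 0 := by
    induction n using Nat.strong_induction_on with
    | _ n ih =>
      have h1 := hsum (x₀ - n - q.natTrailingDegree)
      rw [Finset.sum_eq_single q.natTrailingDegree, sub_add_cancel] at h1
      · have h2 : q.coeff q.natTrailingDegree ≠ 0 := by
          simpa [trailingCoeff] using trailingCoeff_nonzero_iff_nonzero.2 hq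
        simpa [h2] using h1
      · intro i _ hne
        rcases lt_or_gt_of_ne hne with h | h
        · rw [coeff_eq_zero_of_lt_natTrailingDegree h, zero_mul]
        · rcases le_or_gt n (i - q.natTrailingDegree) with h' | h'
          · have h2 := up (i - q.natTrailingDegree - n)
            rw [show x₀ - n - q.natTrailingDegree + i =
              x₀ + ((i - q.natTrailingDegree - n : ℕ) : ℤ) by
                push_cast [h', h.le]; ring, h2, mul_zero]
          · have h2 := ih (n - (i - q.natTrailingDegree)) (by omega)
            rw [show x₀ - n - q.natTrailingDegree + i =
              x₀ - ((n - (i - q.natTrailingDegree) : ℕ) : ℤ) by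
                push_cast [h'.le, h.le]; ring, h2, mul_zero]
      · intro h
        exact absurd (Finset.mem_range.2 (Nat.lt_succ_of_le (natTrailingDegree_le_natDegree q))) h
  ext x
  rcases le_total x₀ x with h | h
  · have := up (x - x₀).toNat
    rwa [Int.toNat_of_nonneg (by omega), add_sub_cancel] at this
  · have := down (x₀ - x).toNat
    rwa [Int.toNat_of_nonneg (by omega), sub_sub_cancel] at this

theorem exists_common_period {V : Set ℂ} (hV : V.Finite) {q : ℂ[X]} (hq : q ≠ 0) :
    ∃ k : ℕ, 0 < k ∧ ∀ r : ℤ → ℂ, (∀ x, r x ∈ V) → aeval seqShift q r = 0 →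
      ∀ x, r (x + k) = r x := by
  let B : Set (ℤ → ℂ) := {r | (∀ x, r x ∈ V) ∧ aeval seqShift q r = 0}
  have : Finite V := hV
  have hB : Finite B := by
    refine Finite.of_injective
      (fun (r : B) (i : Fin q.natDegree) => (⟨r.1 i, r.2.1 i⟩ : V)) fun r s h => ?_
    have h1 : aeval seqShift q (r.1 - s.1) = 0 := by rw [map_sub, r.2.2, s.2.2, sub_zero]
    have h2 := eq_zero_of_aeval_seqShift_eq_zero hq h1 0 fun i hi => by
      have := congrArg Subtype.val (congrFun h ⟨i, hi⟩)
      simpa [sub_eq_zero] using this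
    exact Subtype.ext (sub_eq_zero.1 h2)
  let f : B → B := fun r => ⟨seqShift r.1, fun x => r.2.1 (x + 1), by
    have h : aeval seqShift q (seqShift r.1) = seqShift (aeval seqShift q r.1) := by
      have := congrArg (fun p => aeval seqShift p r.1) (mul_comm q X)
      simpa using this
    rw [h, r.2.2, map_zero]⟩
  have hf : Function.Injective f := fun r s h => Subtype.ext <| funext fun x => by
    have := congrFun (congrArg Subtype.val h) (x - 1)
    simpa [f, seqShift] using this
  let σ : Equiv.Perm B := Equiv.ofBijective f (Finite.injective_iff_bijective.1 hf)
  have hσ (n : ℕ) (r : B) (x : ℤ) : ((σ ^ n) r).1 x = r.1 (x + n) := by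
    induction n generalizing x with
    | zero => simp
    | succ n ih =>
      rw [pow_succ', Equiv.Perm.mul_apply]
      change ((σ ^ n) r).1 (x + 1) = _
      rw [ih, show x + 1 + (n : ℤ) = x + ((n + 1 : ℕ) : ℤ) by push_cast; ring]
  refine ⟨orderOf σ, orderOf_pos σ, fun r h1 h2 x => ?_⟩
  have := hσ (orderOf σ) ⟨r, h1, h2⟩ x
  rw [pow_orderOf_eq_one] at this
  exact this.symm

theorem finite_range_aeval_seqShift (q : ℂ[X]) {r : ℤ → ℂ} (hr : (Set.range r).Finite) :
    (Set.range (aeval seqShift q r)).Finite := by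
  induction q using Polynomial.induction_on' with
  | add p q hp hq =>
    refine (hp.image2 (· + ·) hq).subset ?_
    rintro _ ⟨x, rfl⟩
    exact ⟨_, ⟨x, rfl⟩, _, ⟨x, rfl⟩, by simp⟩
  | monomial n a =>
    refine (hr.image (a * ·)).subset ?_
    rintro _ ⟨x, rfl⟩
    exact ⟨r (x + n), ⟨_, rfl⟩, by simp [aeval_monomial, Module.algebraMap_end_apply,
      seqShift_pow_apply]⟩

theorem aeval_seqShift_eq_zero_iff_periodic (k : ℕ) (r : ℤ → ℂ) :
    aeval seqShift ((X : ℂ[X]) ^ k - 1) r = 0 ↔ ∀ x, r (x + k) = r x := by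
  simp [funext_iff, seqShift_pow_apply, sub_eq_zero]

theorem X_pow_sub_one_ne_zero {k : ℕ} (hk : 0 < k) : (X : ℂ[X]) ^ k - 1 ≠ 0 := by
  simpa using X_pow_sub_C_ne_zero hk (1 : ℂ)

end Sequences

section Fourier

/-- The discrete Fourier coefficient of a sequence, computed on the window `[0, P)`. -/
noncomputable def fourierCoeffOn (P : ℕ) [NeZero P] (k : ZMod P) : (ℤ → ℂ) →ₗ[ℂ] ℂ :=
  LinearMap.proj k ∘ₗ (ZMod.dft : (ZMod P → ℂ) ≃ₗ[ℂ] (ZMod P → ℂ)).toLinearMap ∘ₗ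
    LinearMap.funLeft ℂ ℂ (fun z : ZMod P => (z.val : ℤ))

theorem fourierCoeffOn_apply (P : ℕ) [NeZero P] (k : ZMod P) (r : ℤ → ℂ) :
    fourierCoeffOn P k r = ZMod.dft (fun z : ZMod P => r z.val) k :=
  rfl

theorem periodic_apply_val {P : ℕ} [NeZero P] {r : ℤ → ℂ} (hr : ∀ x, r (x + P) = r x) (x : ℤ) :
    r ((x : ZMod P).val) = r x := by
  rw [ZMod.val_intCast]
  have := (show Function.Periodic r (P : ℤ) from hr).int_mul (x / P) (x % P)
  rw [Int.cast_id, mul_comm, Int.emod_add_mul_ediv] at this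
  exact this.symm

theorem eq_zero_of_fourierCoeffOn {P : ℕ} [NeZero P] {r : ℤ → ℂ}
    (hr : ∀ x, r (x + P) = r x) (h : ∀ k : ZMod P, fourierCoeffOn P k r = 0) : r = 0 := by
  have h1 : ZMod.dft (fun z : ZMod P => r z.val) = 0 := funext h
  rw [LinearEquiv.map_eq_zero_iff] at h1
  ext x
  rw [← periodic_apply_val hr]
  exact congrFun h1 (x : ZMod P)

theorem fourierCoeffOn_aeval {P : ℕ} [NeZero P] {r : ℤ → ℂ}
    (hr : ∀ x, r (x + P) = r x) (k : ZMod P) (q : ℂ[X]) :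
    fourierCoeffOn P k (aeval seqShift q r) =
      q.eval (ZMod.stdAddChar k) * fourierCoeffOn P k r := by
  induction q using Polynomial.induction_on' with
  | add p q hp hq =>
    rw [map_add, LinearMap.add_apply, eval_add, add_mul, ← hp, ← hq, map_add]
  | monomial n a =>
    have key (z : ZMod P) : r ((z.val : ℤ) + n) = r ((z + n).val) := by
      rw [← periodic_apply_val hr]
      simp
    simp only [fourierCoeffOn_apply, ZMod.dft_apply, aeval_monomial, Module.End.mul_apply,
      Module.algebraMap_end_apply, Pi.smul_apply, seqShift_pow_apply, smul_eq_mul, eval_monomial]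
    rw [Finset.mul_sum, ← Equiv.sum_comp (Equiv.addRight (n : ZMod P))
      (fun z => a * ZMod.stdAddChar k ^ n * (ZMod.stdAddChar (-(z * k)) * r z.val))]
    refine Finset.sum_congr rfl fun z _ => ?_
    rw [key, Equiv.coe_addRight, ← AddChar.map_nsmul_eq_pow,
      show -(z * k) = n • k + -((z + n) * k) by rw [nsmul_eq_mul]; ring, AddChar.map_add_eq_mul]
    ring

end Fourier

section Rows

variable {F : ℕ → ℂ[X]} {w : ℕ} {r : ℤ → ℤ → ℂ}

theorem exists_period_of_rows (hF : ∃ i ≤ w, F i ≠ 0)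
    (hfin : ∀ j, (Set.range (r j)).Finite)
    (hrel : ∀ j, ∑ i ∈ Finset.range (w + 1), aeval seqShift (F i) (r (j + i)) = 0)
    (h0 : ∀ j, -(w : ℤ) ≤ j → j < 0 → r j = 0) (n : ℕ) :
    ∃ k : ℕ, 0 < k ∧ ∀ m < n, ∀ x, r (m - w) (x + k) = r (m - w) x := by
  classical
  induction n with
  | zero => exact ⟨1, one_pos, by simp⟩
  | succ n ih =>
    obtain ⟨k, hk, hper⟩ := ih
    obtain ⟨l, hl, hl'⟩ : ∃ l : ℕ, 0 < l ∧ ∀ x, r (n - w) (x + l) = r (n - w) x := by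
      rcases lt_or_ge n w with hn | hn
      · exact ⟨1, one_pos, by simp [h0 (n - w) (by omega) (by omega)]⟩
      · obtain ⟨i₀, hi₀, hFi₀⟩ := hF
        have hP : ∃ i ≤ w, F i ≠ 0 := ⟨i₀, hi₀, hFi₀⟩
        let t := Nat.findGreatest (fun i => F i ≠ 0) w
        have ht : F t ≠ 0 := Nat.findGreatest_spec (P := fun i => F i ≠ 0) hi₀ hFi₀
        have htw : t ≤ w := Nat.findGreatest_le w
        have h1 := congrArg (aeval seqShift ((X : ℂ[X]) ^ k - 1)) (hrel (n - w - t))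
        rw [map_sum, map_zero, Finset.sum_eq_single t] at h1
        · rw [sub_add_cancel, ← Module.End.mul_apply, ← map_mul] at h1
          obtain ⟨l, hl, h⟩ := exists_common_period (hfin (n - w))
            (mul_ne_zero (X_pow_sub_one_ne_zero hk) ht)
          exact ⟨l, hl, h _ (fun x => ⟨x, rfl⟩) h1⟩
        · intro i hi hne
          have hi := Finset.mem_range.1 hi
          rcases lt_or_gt_of_ne hne with h | h
          · rw [← Module.End.mul_apply, ← map_mul, mul_comm, map_mul, Module.End.mul_apply]
            have h2 := (aeval_seqShift_eq_zero_iff_periodic k (r (n - w - t + i))).2 (by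
              have := hper (n - (t - i)) (by omega)
              rwa [show ((n - (t - i) : ℕ) : ℤ) - w = n - w - t + i by
                rw [Nat.cast_sub (by omega), Nat.cast_sub h.le]; ring] at this)
            rw [h2, map_zero]
          · have : F i = 0 := by
              by_contra hne
              exact absurd h (not_lt.2 (Nat.le_findGreatest (P := fun i => F i ≠ 0) (by omega) hne))
            rw [this, map_zero, LinearMap.zero_apply, map_zero]
        · intro h
          exact absurd (Finset.mem_range.2 (by omega)) h
    refine ⟨k * l, Nat.mul_pos hk hl, fun m hm x => ?_⟩
    rcases Nat.lt_succ_iff_lt_or_eq.1 hm with h | rfl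
    · have := (show Function.Periodic (r (m - w)) (k : ℤ) from hper m h).int_mul l x
      rw [← this]
      push_cast
      ring_nf
    · have := (show Function.Periodic (r (m - w)) (l : ℤ) from hl').int_mul k x
      rw [← this]
      push_cast
      ring_nf

theorem row_zero_eq_zero (hF : ∀ ω : ℂ, ∃ i ≤ w, (F i).eval ω ≠ 0)
    (hfin : ∀ j, (Set.range (r j)).Finite)
    (hrel : ∀ j, ∑ i ∈ Finset.range (w + 1), aeval seqShift (F i) (r (j + i)) = 0)
    (h0 : ∀ j, -(w : ℤ) ≤ j → j < 0 → r j = 0) : r 0 = 0 := by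
  classical
  obtain ⟨P, hP, hper⟩ := exists_period_of_rows
    (let ⟨i, hi, h⟩ := hF 0; ⟨i, hi, fun h' => h (by rw [h', eval_zero])⟩) hfin hrel h0
    (2 * w + 1)
  have : NeZero P := ⟨hP.ne'⟩
  have hper' (j : ℤ) (h1 : -(w : ℤ) ≤ j) (h2 : j ≤ w) (x : ℤ) : r j (x + P) = r j x := by
    have := hper (j + w).toNat (by omega) x
    rwa [Int.toNat_of_nonneg (by omega), add_sub_cancel_right] at this
  refine eq_zero_of_fourierCoeffOn (hper' 0 (by omega) (by omega)) fun k => ?_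
  obtain ⟨i₀, hi₀, hFi₀⟩ := hF (ZMod.stdAddChar k)
  let t := Nat.findGreatest (fun i => (F i).eval (ZMod.stdAddChar k : ℂ) ≠ 0) w
  have ht : (F t).eval (ZMod.stdAddChar k : ℂ) ≠ 0 :=
    Nat.findGreatest_spec (P := fun i => (F i).eval (ZMod.stdAddChar k : ℂ) ≠ 0) hi₀ hFi₀
  have htw : t ≤ w := Nat.findGreatest_le w
  have h1 := congrArg (fourierCoeffOn P k) (hrel (-t))
  rw [map_sum, map_zero, Finset.sum_eq_single t] at h1
  · rw [fourierCoeffOn_aeval (hper' _ (by omega) (by omega)), neg_add_cancel] at h1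
    exact (mul_eq_zero.1 h1).resolve_left ht
  · intro i hi hne
    have hi := Finset.mem_range.1 hi
    rcases lt_or_gt_of_ne hne with h | h
    · rw [h0 _ (by omega) (by omega), map_zero, map_zero]
    · rw [fourierCoeffOn_aeval (hper' _ (by omega) (by omega))]
      have : (F i).eval (ZMod.stdAddChar k : ℂ) = 0 := by
        by_contra hne
        exact absurd h (not_lt.2 (Nat.le_findGreatest
          (P := fun i => (F i).eval (ZMod.stdAddChar k : ℂ) ≠ 0) (by omega) hne))
      rw [this, zero_mul]
  · intro h
    exact absurd (Finset.mem_range.2 (by omega)) h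

theorem rows_eq_zero_of_nonneg (hF : ∀ ω : ℂ, ∃ i ≤ w, (F i).eval ω ≠ 0)
    (hfin : ∀ j, (Set.range (r j)).Finite)
    (hrel : ∀ j, ∑ i ∈ Finset.range (w + 1), aeval seqShift (F i) (r (j + i)) = 0)
    (h0 : ∀ j, -(w : ℤ) ≤ j → j < 0 → r j = 0) (n : ℕ) : r n = 0 := by
  induction n using Nat.strong_induction_on with
  | _ n ih =>
    have := row_zero_eq_zero (r := fun j => r (j + n)) hF (fun j => hfin _)
      (fun j => by simpa only [add_right_comm] using hrel (j + n)) (fun j h1 h2 => by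
        rcases lt_or_ge (j + n) 0 with h | h
        · exact h0 _ (by omega) h
        · have := ih (j + n).toNat (by omega)
          rwa [Int.toNat_of_nonneg h] at this)
    simpa using this

/-- A finite-valued array satisfying a linear relation between `w + 1` consecutive rows, whose
coefficient polynomials have no common root, vanishes if `w` consecutive rows vanish. -/
theorem rows_eq_zero (hF : ∀ ω : ℂ, ∃ i ≤ w, (F i).eval ω ≠ 0)
    (hfin : ∀ j, (Set.range (r j)).Finite)
    (hrel : ∀ j, ∑ i ∈ Finset.range (w + 1), aeval seqShift (F i) (r (j + i)) = 0)
    (h0 : ∀ j, -(w : ℤ) ≤ j → j < 0 → r j = 0) (j : ℤ) : r j = 0 := by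
  rcases le_or_gt 0 j with h | h
  · have := rows_eq_zero_of_nonneg hF hfin hrel h0 j.toNat
    rwa [Int.toNat_of_nonneg h] at this
  · have := rows_eq_zero_of_nonneg (F := fun i => F (w - i)) (r := fun j => r (-1 - w - j)) (w := w)
      (fun ω => by
        obtain ⟨i, hi, h⟩ := hF ω
        exact ⟨w - i, by omega, by rwa [Nat.sub_sub_self hi]⟩)
      (fun j => hfin _)
      (fun j => by
        rw [← hrel (-1 - w - j - w), ← Finset.sum_range_reflect]
        refine Finset.sum_congr rfl fun i hi => ?_
        have hi := Finset.mem_range.1 hi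
        rw [show w + 1 - 1 - i = w - i by omega, Nat.sub_sub_self (by omega),
          Nat.cast_sub (by omega)]
        congr 2
        ring)
      (fun j h1 h2 => h0 _ (by omega) (by omega))
    rcases lt_or_ge j (-w) with h' | h'
    · have := this (-1 - w - j).toNat
      rwa [Int.toNat_of_nonneg (by omega), sub_sub_cancel] at this
    · exact h0 j h' h

end Rows

section MorseHedlund

variable {B : Type*}

/-- The word of length `s` read in `σ` at position `x`. -/
def wordAt (σ : ℤ → B) (s : ℕ) (x : ℤ) : Fin s → B := fun i => σ (x + i)

theorem wordAt_eq_iff {σ : ℤ → B} {s : ℕ} {x y : ℤ} :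
    wordAt σ s x = wordAt σ s y ↔ ∀ i < s, σ (x + i) = σ (y + i) := by
  simp only [wordAt, funext_iff, Fin.forall_iff]

/-- **Morse–Hedlund**: a bi-infinite sequence with at most `s` words of length `s` is periodic. -/
theorem exists_period_of_ncard_words_le [Finite B] (σ : ℤ → B) (s : ℕ)
    (h : (Set.range (wordAt σ s)).ncard ≤ s) : ∃ k : ℕ, 0 < k ∧ ∀ x, σ (x + k) = σ x := by
  have hfin (j : ℕ) : (Set.range (wordAt σ j)).Finite := Set.toFinite _
  obtain ⟨j, hj⟩ : ∃ j, (Set.range (wordAt σ (j + 1))).ncard ≤ (Set.range (wordAt σ j)).ncard := by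
    by_contra! hlt
    have (j : ℕ) : j < (Set.range (wordAt σ j)).ncard := by
      induction j with
      | zero => exact (Set.ncard_pos (hfin 0)).2 ⟨_, 0, rfl⟩
      | succ j ih => have := hlt j; omega
    exact absurd (this s) (not_lt.2 h)
  have hfwd (x y : ℤ) (hxy : wordAt σ j x = wordAt σ j y) :
      wordAt σ (j + 1) x = wordAt σ (j + 1) y := by
    have himg : (fun u : Fin (j + 1) → B => u ∘ Fin.castSucc) '' Set.range (wordAt σ (j + 1)) =
        Set.range (wordAt σ j) := by
      rw [← Set.range_comp]; rfl
    refine Set.injOn_of_ncard_image_eq (f := fun u : Fin (j + 1) → B => u ∘ Fin.castSucc)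
      ?_ (hfin _) ⟨x, rfl⟩ ⟨y, rfl⟩ hxy
    exact le_antisymm (Set.ncard_image_le (hfin _)) (himg ▸ hj)
  have hbwd (x y : ℤ) (hxy : wordAt σ j (x + 1) = wordAt σ j (y + 1)) :
      wordAt σ (j + 1) x = wordAt σ (j + 1) y := by
    have hcomp (x : ℤ) : wordAt σ (j + 1) x ∘ Fin.succ = wordAt σ j (x + 1) := by
      ext i
      simp only [wordAt, Function.comp_apply, Fin.val_succ]
      congr 1
      push_cast
      ring
    have himg : (fun u : Fin (j + 1) → B => u ∘ Fin.succ) '' Set.range (wordAt σ (j + 1)) =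
        Set.range (wordAt σ j) := by
      ext u
      constructor
      · rintro ⟨_, ⟨x, rfl⟩, rfl⟩
        exact ⟨x + 1, (hcomp x).symm⟩
      · rintro ⟨x, rfl⟩
        exact ⟨_, ⟨x - 1, rfl⟩, by simpa using hcomp (x - 1)⟩
    refine Set.injOn_of_ncard_image_eq (f := fun u : Fin (j + 1) → B => u ∘ Fin.succ)
      ?_ (hfin _) ⟨x, rfl⟩ ⟨y, rfl⟩ ((hcomp x).trans (hxy.trans (hcomp y).symm))
    exact le_antisymm (Set.ncard_image_le (hfin _)) (himg ▸ hj)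
  obtain ⟨a, b, hab, heq⟩ : ∃ a b : ℤ, a < b ∧ wordAt σ j a = wordAt σ j b := by
    obtain ⟨a, b, hne, h⟩ := Finite.exists_ne_map_eq_of_infinite (wordAt σ j)
    rcases lt_or_gt_of_ne hne with h' | h'
    · exact ⟨a, b, h', h⟩
    · exact ⟨b, a, h', h.symm⟩
  have hup (n : ℕ) : wordAt σ j (a + n) = wordAt σ j (b + n) := by
    induction n with
    | zero => simpa using heq
    | succ n ih =>
      rw [wordAt_eq_iff]
      intro i hi
      have := wordAt_eq_iff.1 (hfwd _ _ ih) (i + 1) (by omega)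
      rw [show a + ((n + 1 : ℕ) : ℤ) + i = a + n + ((i + 1 : ℕ) : ℤ) by push_cast; ring, this]
      push_cast
      ring_nf
  have hdown (n : ℕ) : wordAt σ j (a - n) = wordAt σ j (b - n) := by
    induction n with
    | zero => simpa using heq
    | succ n ih =>
      have := hbwd (a - (n + 1 : ℕ)) (b - (n + 1 : ℕ)) (by
        push_cast
        rwa [show a - (n + 1 : ℤ) + 1 = a - n by ring, show b - (n + 1 : ℤ) + 1 = b - n by ring])
      rw [wordAt_eq_iff] at this ⊢
      exact fun i hi => this i (by omega)
  have hall (x : ℤ) : wordAt σ j x = wordAt σ j (b + (x - a)) := by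
    rcases le_total a x with h | h
    · have := hup (x - a).toNat
      rwa [Int.toNat_of_nonneg (by omega), add_sub_cancel] at this
    · have := hdown (a - x).toNat
      rwa [Int.toNat_of_nonneg (by omega), sub_sub_cancel,
        show b - (a - x) = b + (x - a) by ring] at this
  refine ⟨(b - a).toNat, by omega, fun x => ?_⟩
  rw [Int.toNat_of_nonneg (by omega)]
  have := wordAt_eq_iff.1 (hfwd _ _ (hall x)) 0 (by omega)
  simp only [Nat.cast_zero, add_zero] at this
  rw [this]
  ring_nf

end MorseHedlund

section Counting

/-- The number of points of `f '' S` having several preimages in `S` is at most the number of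
points lost by `f`. -/
theorem ncard_image_add_ncard_nonunique_le {α β : Type*} {S : Set α} (hS : S.Finite) (f : α → β) :
    (f '' S).ncard + {b | ∃ x ∈ S, ∃ y ∈ S, f x = b ∧ f y = b ∧ x ≠ y}.ncard ≤ S.ncard := by
  classical
  have hsec (b : f '' S) : ∃ x ∈ S, f x = b := b.2
  choose g hgS hg using hsec
  have h1 : (Set.range g).ncard = (f '' S).ncard := by
    rw [← Set.image_univ, Set.ncard_image_of_injective _ fun b c h => Subtype.ext <| by
      rw [← hg b, h, hg c], Set.ncard_univ]
    rfl
  have hsub : Set.range g ⊆ S := by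
    rintro _ ⟨b, rfl⟩
    exact hgS b
  have h2 : {b | ∃ x ∈ S, ∃ y ∈ S, f x = b ∧ f y = b ∧ x ≠ y} ⊆ f '' (S \ Set.range g) := by
    rintro b ⟨x, hx, y, hy, hxb, hyb, hne⟩
    have hmem {z : α} (hz : z ∈ S) (hzb : f z = b) (hzr : z ∈ Set.range g) :
        z = g ⟨b, x, hx, hxb⟩ := by
      obtain ⟨c, rfl⟩ := hzr
      congr 1
      exact Subtype.ext ((hg c).symm.trans hzb)
    by_cases hxr : x ∈ Set.range g
    · refine ⟨y, ⟨hy, fun hyr => hne ?_⟩, hyb⟩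
      rw [hmem hx hxb hxr, hmem hy hyb hyr]
    · exact ⟨x, ⟨hx, hxr⟩, hxb⟩
  have h3 := (Set.ncard_le_ncard h2 ((hS.sdiff).image f)).trans (Set.ncard_image_le hS.sdiff)
  have h4 := Set.ncard_sdiff_add_ncard_of_subset hsub hS
  omega

end Counting

section Compactness

variable {A : Type*} [TopologicalSpace A] {Y : Set (ℤ × ℤ → A)}

/-- A subshift: a closed set of configurations that is invariant under translations. -/
structure IsSubshift (Y : Set (ℤ × ℤ → A)) : Prop where
  isClosed : IsClosed Y
  shift_mem : ∀ c ∈ Y, ∀ t : ℤ × ℤ, (fun z => c (z + t)) ∈ Y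

theorem exists_limit [DiscreteTopology A] [Finite A] {ι : Type*} [Countable ι]
    (hY : IsClosed Y) (c : ℕ → ι → ℤ × ℤ → A) (hc : ∀ n i, c n i ∈ Y) :
    ∃ (d : ι → ℤ × ℤ → A) (φ : ℕ → ℕ), StrictMono φ ∧ (∀ i, d i ∈ Y) ∧
      ∀ i z, ∀ᶠ n in atTop, c (φ n) i z = d i z := by
  have hcpt : IsCompact (Set.univ.pi fun _ : ι => Y) := isCompact_univ_pi fun _ => hY.isCompact
  obtain ⟨d, hd, φ, hφ, hlim⟩ := hcpt.tendsto_subseq (x := c) fun n i _ => hc n i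
  refine ⟨d, φ, hφ, fun i => hd i trivial, fun i z => ?_⟩
  have := tendsto_pi_nhds.1 (tendsto_pi_nhds.1 hlim i) z
  rwa [nhds_discrete, tendsto_pure] at this

end Compactness

section Patterns

variable {A : Type*} {Y : Set (ℤ × ℤ → A)} {D D' : Finset (ℤ × ℤ)}

/-- The number of patterns of shape `D` occurring (at the origin) in the elements of `Y`. -/
noncomputable def patternCount (Y : Set (ℤ × ℤ → A)) (D : Finset (ℤ × ℤ)) : ℕ :=
  ((D.restrict : (ℤ × ℤ → A) → D → A) '' Y).ncard

theorem restrict_eq_restrict_iff {c d : ℤ × ℤ → A} :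
    D.restrict c = D.restrict d ↔ ∀ z ∈ D, c z = d z := by
  simp [funext_iff]

theorem restrict₂_image (h : D ⊆ D') :
    (Finset.restrict₂ (π := fun _ => A) h) '' (D'.restrict '' Y) = D.restrict '' Y := by
  rw [← Set.image_comp]
  rfl

theorem patternCount_mono [Finite A] (h : D ⊆ D') : patternCount Y D ≤ patternCount Y D' := by
  rw [patternCount, ← restrict₂_image h]
  exact Set.ncard_image_le (Set.toFinite _)

theorem eqOn_of_patternCount_le [Finite A] (h : D ⊆ D')
    (hle : patternCount Y D' ≤ patternCount Y D) {c d : ℤ × ℤ → A} (hc : c ∈ Y) (hd : d ∈ Y)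
    (hcd : ∀ z ∈ D, c z = d z) : ∀ z ∈ D', c z = d z := by
  rw [← restrict_eq_restrict_iff]
  refine Set.injOn_of_ncard_image_eq (f := (Finset.restrict₂ (π := fun _ => A) h))
    (s := D'.restrict '' Y) ?_ (Set.toFinite _) ⟨c, hc, rfl⟩ ⟨d, hd, rfl⟩
    (restrict_eq_restrict_iff.2 hcd)
  rw [restrict₂_image]
  exact le_antisymm (by simpa [patternCount] using patternCount_mono h) hle

theorem patternCount_empty (hY : Y.Nonempty) : patternCount Y ∅ = 1 := by
  rw [patternCount, Set.ncard_eq_one]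
  obtain ⟨c, hc⟩ := hY
  exact ⟨Finset.restrict ∅ c, Set.eq_singleton_iff_unique_mem.2
    ⟨⟨c, hc, rfl⟩, fun p _ => Subsingleton.elim _ _⟩⟩

/-- Low complexity yields an affine relation satisfied by all patterns. -/
theorem exists_affine_relation [Finite A] (hY : Y.Nonempty) (v : A → ℂ)
    (hle : patternCount Y D ≤ D.card) :
    ∃ (a : ℤ × ℤ → ℂ) (κ : ℂ), (∃ z ∈ D, a z ≠ 0) ∧ ∀ c ∈ Y, ∑ z ∈ D, a z * v (c z) = κ := by
  classical
  let Q : Set (D → A) := D.restrict '' Y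
  have : Fintype Q := Fintype.ofFinite Q
  let Φ : (Option D → ℂ) →ₗ[ℂ] (Q → ℂ) :=
    { toFun := fun a q => a none + ∑ z : D, a (some z) * v (q.1 z)
      map_add' := fun a b => by
        ext q
        simp only [Pi.add_apply, add_mul, Finset.sum_add_distrib]
        ring
      map_smul' := fun t a => by
        ext q
        simp only [Pi.smul_apply, smul_eq_mul, RingHom.id_apply, mul_add, Finset.mul_sum,
          mul_assoc] }
  have hker : LinearMap.ker Φ ≠ ⊥ := by
    refine LinearMap.ker_ne_bot_of_finrank_lt ?_
    have hQ : Fintype.card Q = patternCount Y D := by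
      rw [patternCount, ← Nat.card_coe_set_eq, Nat.card_eq_fintype_card]
    simp only [Module.finrank_fintype_fun_eq_card, Fintype.card_option, Fintype.card_coe]
    omega
  obtain ⟨a, ha, hne⟩ := Submodule.exists_mem_ne_zero_of_ne_bot hker
  have hrel (c : ℤ × ℤ → A) (hc : c ∈ Y) : a none + ∑ z : D, a (some z) * v (c z) = 0 :=
    congrFun (LinearMap.mem_ker.1 ha) ⟨D.restrict c, c, hc, rfl⟩
  refine ⟨fun z => if h : z ∈ D then a (some ⟨z, h⟩) else 0, -a none, ?_, fun c hc => ?_⟩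
  · by_contra! h
    have hz (z : D) : a (some z) = 0 := by simpa using h z z.2
    obtain ⟨c, hc⟩ := hY
    have h1 := hrel c hc
    simp only [hz, zero_mul, Finset.sum_const_zero, add_zero] at h1
    exact hne (funext fun o => by cases o with
      | none => exact h1
      | some z => exact hz z)
  · rw [← Finset.sum_coe_sort]
    simp only [Subtype.coe_eta, Finset.coe_mem, dite_true]
    exact (neg_eq_of_add_eq_zero_right (hrel c hc)).symm

end Patterns

section RowRelation

variable {A : Type*} {Y : Set (ℤ × ℤ → A)} {D : Finset (ℤ × ℤ)}

/-- The `j`-th row of a configuration, read through a numerical encoding of the alphabet. -/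
def row (v : A → ℂ) (c : ℤ × ℤ → A) (j : ℤ) : ℤ → ℂ := fun x => v (c (x, j))

theorem exists_row_polynomials {a : ℤ × ℤ → ℂ} (ha : ∃ z ∈ D, a z ≠ 0) {y₀ : ℤ} {w : ℕ}
    (hD : ∀ z ∈ D, y₀ ≤ z.2 ∧ z.2 ≤ y₀ + w) :
    ∃ F : ℕ → ℂ[X], (∃ i ≤ w, F i ≠ 0) ∧ ∃ x₀ : ℤ, ∀ (r : ℤ → ℤ → ℂ) (j x : ℤ),
      ∑ i ∈ Finset.range (w + 1), aeval seqShift (F i) (r (j + i)) x =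
        ∑ z ∈ D, a z * r (z.2 + (j - y₀)) (z.1 + (x - x₀)) := by
  classical
  obtain ⟨x₀, hx₀⟩ := (D.image Prod.fst).bddBelow
  have hx₀ (z) (hz : z ∈ D) : x₀ ≤ z.1 := hx₀ (Finset.mem_coe.2 (Finset.mem_image_of_mem _ hz))
  refine ⟨fun i => ∑ z ∈ D, if z.2 = y₀ + i then monomial (z.1 - x₀).toNat (a z) else 0,
    ?_, x₀, fun r j x => ?_⟩
  · obtain ⟨z₀, hz₀, hne⟩ := ha
    have := hD z₀ hz₀
    refine ⟨(z₀.2 - y₀).toNat, by omega, fun h => hne ?_⟩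
    have h1 := congrArg (fun p : ℂ[X] => p.coeff (z₀.1 - x₀).toNat) h
    simp only [finsetSum_coeff, coeff_zero] at h1
    rw [Finset.sum_eq_single_of_mem z₀ hz₀, if_pos (by omega), coeff_monomial, if_pos rfl] at h1
    · exact h1
    · intro z hz hzne
      split_ifs with h2
      · rw [coeff_monomial, if_neg]
        intro h3
        have := hx₀ z hz
        have := hx₀ z₀ hz₀
        exact hzne (Prod.ext (by omega) (by omega))
      · rfl
  · simp only [map_sum, LinearMap.sum_apply, Finset.sum_apply]
    rw [Finset.sum_comm]
    refine Finset.sum_congr rfl fun z hz => ?_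
    have := hD z hz
    have := hx₀ z hz
    rw [Finset.sum_eq_single_of_mem (z.2 - y₀).toNat (Finset.mem_range.2 (by omega)),
      if_pos (by omega), aeval_monomial]
    · simp only [Module.End.mul_apply, Module.algebraMap_end_apply, Pi.smul_apply,
        seqShift_pow_apply, smul_eq_mul]
      rw [Int.toNat_of_nonneg (by omega), Int.toNat_of_nonneg (by omega)]
      ring_nf
    · intro i _ hne
      rw [if_neg (by omega), map_zero]
      rfl

theorem exists_common_factor {F : ℕ → ℂ[X]} {w : ℕ} (hF : ∃ i ≤ w, F i ≠ 0) :
    ∃ (ψ : ℂ[X]) (G : ℕ → ℂ[X]), ψ ≠ 0 ∧ (∀ i ≤ w, F i = ψ * G i) ∧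
      ∀ ω : ℂ, ∃ i ≤ w, (G i).eval ω ≠ 0 := by
  classical
  obtain ⟨i₀, hi₀, hne⟩ := hF
  let P : ℕ → Prop := fun n => ∃ ψ : ℂ[X], (∀ i ≤ w, ψ ∣ F i) ∧ ψ.natDegree = n
  have hP0 : P 0 := ⟨1, fun i _ => one_dvd _, natDegree_one⟩
  obtain ⟨ψ, hψ, hdeg⟩ := Nat.findGreatest_spec (P := P) (Nat.zero_le (F i₀).natDegree) hP0
  have hψ0 : ψ ≠ 0 := by
    rintro rfl
    exact hne (zero_dvd_iff.1 (hψ i₀ hi₀))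
  have hdvd (i : ℕ) : ∃ g, i ≤ w → F i = ψ * g := by
    by_cases hi : i ≤ w
    · obtain ⟨g, hg⟩ := hψ i hi
      exact ⟨g, fun _ => hg⟩
    · exact ⟨0, fun h => absurd h hi⟩
  choose G hG using hdvd
  refine ⟨ψ, G, hψ0, hG, fun ω => ?_⟩
  by_contra! h
  have hdvd (i : ℕ) (hi : i ≤ w) : ψ * (X - C ω) ∣ F i := by
    rw [hG i hi]
    exact mul_dvd_mul_left _ (dvd_iff_isRoot.2 (h i hi))
  have hdeg' : (ψ * (X - C ω)).natDegree = ψ.natDegree + 1 := by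
    rw [natDegree_mul hψ0 (X_sub_C_ne_zero ω), natDegree_X_sub_C]
  have hle := Nat.le_findGreatest (P := P) (natDegree_le_of_dvd (hdvd i₀ hi₀) hne)
    ⟨_, hdvd, rfl⟩
  omega

/-- The data of a linear relation between `w + 1` consecutive rows valid in all of `Y`, with the
common factor `ψ` of its coefficients taken out. -/
structure RowRelation (v : A → ℂ) (Y : Set (ℤ × ℤ → A)) (w : ℕ) (ψ : ℂ[X]) (G : ℕ → ℂ[X])
    (κ : ℂ) : Prop where
  ne_zero : ψ ≠ 0
  no_common_root : ∀ ω : ℂ, ∃ i ≤ w, (G i).eval ω ≠ 0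
  rel : ∀ c ∈ Y, ∀ j, ∑ i ∈ Finset.range (w + 1), aeval seqShift (ψ * G i) (row v c (j + i)) =
    fun _ => κ

theorem exists_rowRelation [TopologicalSpace A] [Finite A] (hY : IsSubshift Y) (hne : Y.Nonempty)
    (v : A → ℂ) (hle : patternCount Y D ≤ D.card) {y₀ : ℤ} {w : ℕ}
    (hD : ∀ z ∈ D, y₀ ≤ z.2 ∧ z.2 ≤ y₀ + w) :
    ∃ ψ G κ, RowRelation v Y w ψ G κ := by
  obtain ⟨a, κ, ha, hrel⟩ := exists_affine_relation hne v hle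
  obtain ⟨F, hF, x₀, hF'⟩ := exists_row_polynomials ha hD
  obtain ⟨ψ, G, hψ, hG, hroot⟩ := exists_common_factor hF
  refine ⟨ψ, G, κ, hψ, hroot, fun c hc j => funext fun x => ?_⟩
  rw [Finset.sum_apply]
  refine Eq.trans (Finset.sum_congr rfl fun i hi => ?_)
    ((hF' (row v c) j x).trans (hrel _ (hY.shift_mem c hc (x - x₀, j - y₀))))
  rw [hG i (by simpa [Nat.lt_succ_iff] using hi)]

theorem finite_range_row [Finite A] (v : A → ℂ) (c : ℤ × ℤ → A) (j : ℤ) :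
    (Set.range (row v c j)).Finite :=
  (Set.finite_range v).subset (by rintro _ ⟨x, rfl⟩; exact ⟨_, rfl⟩)

/-- Two elements of `Y` that agree on a half plane differ by an array killed by `ψ`. -/
theorem RowRelation.aeval_sub_eq_zero [Finite A] {v : A → ℂ} {w : ℕ} {ψ : ℂ[X]} {G : ℕ → ℂ[X]}
    {κ : ℂ} (h : RowRelation v Y w ψ G κ) {d e : ℤ × ℤ → A} (hd : d ∈ Y) (he : e ∈ Y)
    (hde : ∀ z : ℤ × ℤ, z.2 < 0 → d z = e z) (j : ℤ) :
    aeval seqShift ψ (row v d j - row v e j) = 0 := by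
  refine rows_eq_zero (r := fun j => aeval seqShift ψ (row v d j - row v e j))
    h.no_common_root (fun j => finite_range_aeval_seqShift ψ ?_) (fun j => ?_) (fun j _ hj => ?_) j
  · refine ((finite_range_row v d j).image2 (· - ·) (finite_range_row v e j)).subset ?_
    rintro _ ⟨x, rfl⟩
    exact ⟨_, ⟨x, rfl⟩, _, ⟨x, rfl⟩, rfl⟩
  · have := congrArg₂ (· - ·) (h.rel d hd j) (h.rel e he j)
    simp only [← Finset.sum_sub_distrib, ← map_sub, sub_self] at this
    simpa only [← Module.End.mul_apply, ← map_mul, mul_comm] using this.trans (by ext; simp)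
  · have : row v d j = row v e j := funext fun x => congrArg v (hde (x, j) hj)
    rw [this, sub_self, map_zero]

/-- An element of `Y` having `w` consecutive rows with a common period is periodic. -/
theorem RowRelation.exists_period [Finite A] {v : A → ℂ} (hv : Function.Injective v) {w : ℕ}
    {ψ : ℂ[X]} {G : ℕ → ℂ[X]} {κ : ℂ} (h : RowRelation v Y w ψ G κ) {c : ℤ × ℤ → A} (hc : c ∈ Y)
    (b : ℤ) {k : ℕ} (hk : 0 < k)
    (hper : ∀ j, b - w ≤ j → j < b → ∀ x, c (x + k, j) = c (x, j)) :
    ∃ l : ℕ, 0 < l ∧ ∀ x j, c (x + l, j) = c (x, j) := by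
  have hzero (j : ℤ) : aeval seqShift ((X ^ k - 1) * ψ) (row v c j) = 0 := by
    have := rows_eq_zero (r := fun j => aeval seqShift ((X ^ k - 1) * ψ) (row v c (j + b)))
      h.no_common_root (fun j => finite_range_aeval_seqShift _ (finite_range_row v c _))
      (fun j => ?_) (fun j h1 h2 => ?_) (j - b)
    · simpa using this
    · have h1 := congrArg (aeval seqShift ((X : ℂ[X]) ^ k - 1)) (h.rel c hc (j + b))
      rw [map_sum, (aeval_seqShift_eq_zero_iff_periodic k _).2 fun _ => rfl] at h1
      rw [← h1]
      refine Finset.sum_congr rfl fun i _ => ?_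
      rw [← Module.End.mul_apply, ← Module.End.mul_apply, ← map_mul, ← map_mul, add_right_comm]
      congr 2
      ring
    · have h1 := (aeval_seqShift_eq_zero_iff_periodic k (row v c (j + b))).2 fun x =>
        congrArg v (hper (j + b) (by omega) (by omega) x)
      rw [mul_comm, map_mul, Module.End.mul_apply, h1, map_zero]
  obtain ⟨l, hl, hl'⟩ := exists_common_period (Set.finite_range v)
    (mul_ne_zero (X_pow_sub_one_ne_zero hk) h.ne_zero)
  exact ⟨l, hl, fun x j => hv (hl' (row v c j) (fun x => ⟨_, rfl⟩) (hzero j) x)⟩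

end RowRelation

section Determinism

variable {A : Type*} {Y : Set (ℤ × ℤ → A)}

/-- The orbit of every element of `Y` is dense in `Y`, expressed through finite patterns. -/
def DenseOrbits (Y : Set (ℤ × ℤ → A)) : Prop :=
  ∀ d ∈ Y, ∀ e ∈ Y, ∀ Q : Finset (ℤ × ℤ), ∃ t : ℤ × ℤ, ∀ z ∈ Q, e (z + t) = d z

/-- Two elements of `Y` agree below the horizontal axis but not on it. -/
def UpNondeterministic (Y : Set (ℤ × ℤ → A)) : Prop :=
  ∃ d ∈ Y, ∃ e ∈ Y, (∀ z : ℤ × ℤ, z.2 < 0 → d z = e z) ∧ ∃ x, d (x, 0) ≠ e (x, 0)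

/-- Two elements of `Y` agree above the horizontal axis but not on it. -/
def DownNondeterministic (Y : Set (ℤ × ℤ → A)) : Prop :=
  ∃ d ∈ Y, ∃ e ∈ Y, (∀ z : ℤ × ℤ, 0 < z.2 → d z = e z) ∧ ∃ x, d (x, 0) ≠ e (x, 0)

/-- Two configurations agree on the rows `b, …, b + W - 1`. -/
def AgreeOnRows (b : ℤ) (W : ℕ) (d e : ℤ × ℤ → A) : Prop :=
  ∀ z : ℤ × ℤ, b ≤ z.2 → z.2 < b + W → d z = e z

theorem AgreeOnRows.symm {b : ℤ} {W : ℕ} {d e : ℤ × ℤ → A} (h : AgreeOnRows b W d e) :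
    AgreeOnRows b W e d := fun z h1 h2 => (h z h1 h2).symm

theorem AgreeOnRows.trans {b : ℤ} {W : ℕ} {d e f : ℤ × ℤ → A} (h : AgreeOnRows b W d e)
    (h' : AgreeOnRows b W e f) : AgreeOnRows b W d f :=
  fun z h1 h2 => (h z h1 h2).trans (h' z h1 h2)

theorem exists_window [TopologicalSpace A] [DiscreteTopology A] [Finite A] (hY : IsSubshift Y)
    (hdown : ¬ DownNondeterministic Y) :
    ∃ W : ℕ, 0 < W ∧ ∀ d ∈ Y, ∀ e ∈ Y, AgreeOnRows 0 W d e → ∀ x, d (x, -1) = e (x, -1) := by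
  by_contra! h
  choose d hd e he hde x hx using fun n : ℕ => h (n + 1) n.succ_pos
  obtain ⟨f, φ, hφ, hf, hlim⟩ := exists_limit hY.isClosed
    (fun n (i : Bool) z => (if i then d n else e n) (z + (x n, -1)))
    (fun n i => by cases i <;> simp [hY.shift_mem, hd, he])
  refine hdown ⟨f true, hf _, f false, hf _, fun z hz => ?_, 0, fun h0 => ?_⟩
  · obtain ⟨n, h1, h2, hn⟩ := ((hlim true z).and ((hlim false z).and
      (hφ.tendsto_atTop.eventually_ge_atTop z.2.toNat))).exists
    rw [← h1, ← h2]
    exact hde (φ n) _ (by simp only [Prod.snd_add]; omega) (by simp only [Prod.snd_add]; omega)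
  · obtain ⟨n, h1, h2⟩ := ((hlim true (0, 0)).and (hlim false (0, 0))).exists
    refine hx (φ n) ?_
    simpa using h1.trans (h0.trans h2.symm)

theorem AgreeOnRows.eq_below [TopologicalSpace A] (hY : IsSubshift Y) {W : ℕ}
    (hW : ∀ d ∈ Y, ∀ e ∈ Y, AgreeOnRows 0 W d e → ∀ x, d (x, -1) = e (x, -1))
    {d e : ℤ × ℤ → A} (hd : d ∈ Y) (he : e ∈ Y) {b : ℤ} (h : AgreeOnRows b W d e)
    (z : ℤ × ℤ) (hz : z.2 < b + W) : d z = e z := by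
  have key (n : ℕ) : ∀ z : ℤ × ℤ, b - n ≤ z.2 → z.2 < b + W → d z = e z := by
    induction n with
    | zero => exact fun z h1 h2 => h z (by simpa using h1) h2
    | succ n ih =>
      intro z h1 h2
      by_cases h3 : b - n ≤ z.2
      · exact ih z h3 h2
      · have := hW _ (hY.shift_mem d hd (0, b - n)) _ (hY.shift_mem e he (0, b - n))
          (fun z h1 h2 => ih _ (by simp only [Prod.snd_add]; omega)
            (by simp only [Prod.snd_add]; omega)) z.1
        have hz : ((z.1, -1) : ℤ × ℤ) + (0, b - n) = z := by
          ext <;> simp only [Prod.fst_add, Prod.snd_add] <;> push_cast at h1 <;> omega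
        simpa only [hz] using this
  exact key (b - z.2).toNat z (by omega) hz

theorem exists_upward_shift [TopologicalSpace A] [DiscreteTopology A] [Finite A]
    (hY : IsSubshift Y) (hdense : DenseOrbits Y) {d e : ℤ × ℤ → A} (hd : d ∈ Y) (he : e ∈ Y)
    (Q : Finset (ℤ × ℤ)) : ∃ t : ℤ × ℤ, 0 ≤ t.2 ∧ ∀ z ∈ Q, e (z + t) = d z := by
  obtain ⟨f, φ, hφ, hf, hlim⟩ := exists_limit hY.isClosed
    (fun n (_ : Unit) z => e (z + (0, (n : ℤ)))) (fun n _ => hY.shift_mem e he _)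
  obtain ⟨t, ht⟩ := hdense d hd (f ()) (hf ()) Q
  obtain ⟨n, h1, hn⟩ := (((Filter.eventually_all_finset Q).2 fun z _ => hlim () (z + t)).and
      (hφ.tendsto_atTop.eventually_ge_atTop (-t.2).toNat)).exists
  refine ⟨t + (0, (φ n : ℤ)), by simp only [Prod.snd_add]; omega, fun z hz => ?_⟩
  rw [← ht z hz, ← h1 z hz, add_assoc]

/-- There are `q` elements of `Y` whose rows have the same image as those of `d` under `ψ`,
and that differ pairwise on the rows `0, …, W - 1`. -/
def Separated (v : A → ℂ) (Y : Set (ℤ × ℤ → A)) (ψ : ℂ[X]) (W q : ℕ) (d : ℤ × ℤ → A) : Prop :=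
  ∃ es : Fin q → ℤ × ℤ → A,
    (∀ i, es i ∈ Y ∧ ∀ j, aeval seqShift ψ (row v d j) = aeval seqShift ψ (row v (es i) j)) ∧
    ∀ i j, AgreeOnRows 0 W (es i) (es j) → i = j

theorem aeval_row_apply (v : A → ℂ) (ψ : ℂ[X]) (c : ℤ × ℤ → A) (j x : ℤ) :
    aeval seqShift ψ (row v c j) x =
      ∑ i ∈ Finset.range (ψ.natDegree + 1), ψ.coeff i * v (c (x + i, j)) :=
  aeval_seqShift_apply _ _ _

theorem aeval_row_shift (v : A → ℂ) (ψ : ℂ[X]) (c : ℤ × ℤ → A) (t : ℤ × ℤ) (j x : ℤ) :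
    aeval seqShift ψ (row v (fun z => c (z + t)) j) x =
      aeval seqShift ψ (row v c (j + t.2)) (x + t.1) := by
  rw [aeval_row_apply, aeval_row_apply]
  refine Finset.sum_congr rfl fun i _ => ?_
  rw [Prod.add_def, add_right_comm]

variable {v : A → ℂ} {ψ : ℂ[X]} {W q : ℕ}

/-- A box detecting differences on the rows `0, …, W - 1` between configurations whose rows have
the same image under `ψ`. -/
theorem agreeOnRows_of_eqOn_box (hv : Function.Injective v) (hψ : ψ ≠ 0) {d e : ℤ × ℤ → A}
    (h : ∀ j, aeval seqShift ψ (row v d j) = aeval seqShift ψ (row v e j))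
    (hbox : ∀ z ∈ Finset.Ico (0 : ℤ) ψ.natDegree ×ˢ Finset.Ico (0 : ℤ) W, d z = e z) :
    AgreeOnRows 0 W d e := by
  intro z h1 h2
  have := eq_zero_of_aeval_seqShift_eq_zero hψ
    (show aeval seqShift ψ (row v d z.2 - row v e z.2) = 0 by rw [map_sub, h, sub_self]) 0
    (fun i hi => by
      rw [Pi.sub_apply, sub_eq_zero]
      refine congrArg v (hbox _ ?_)
      simp only [Finset.mem_product, Finset.mem_Ico]
      omega)
  exact hv (sub_eq_zero.1 (congrFun this z.1))

theorem Separated.le_card [Finite A] (hv : Function.Injective v) (hψ : ψ ≠ 0) {d : ℤ × ℤ → A}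
    (h : Separated v Y ψ W q d) :
    q ≤ Nat.card ((Finset.Ico (0 : ℤ) ψ.natDegree ×ˢ Finset.Ico (0 : ℤ) W :
      Finset (ℤ × ℤ)) → A) := by
  obtain ⟨es, h1, h2⟩ := h
  have := Nat.card_le_card_of_injective
    (fun i => (Finset.Ico (0 : ℤ) ψ.natDegree ×ˢ Finset.Ico (0 : ℤ) W).restrict (es i))
    (fun i j hij => h2 i j (agreeOnRows_of_eqOn_box hv hψ
      (fun y => ((h1 i).2 y).symm.trans ((h1 j).2 y)) (restrict_eq_restrict_iff.1 hij)))
  simpa using this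

theorem Separated.shift [TopologicalSpace A] (hY : IsSubshift Y)
    (hW : ∀ d ∈ Y, ∀ e ∈ Y, AgreeOnRows 0 W d e → ∀ x, d (x, -1) = e (x, -1))
    {d : ℤ × ℤ → A} (h : Separated v Y ψ W q d) {t : ℤ × ℤ} (ht : 0 ≤ t.2) :
    Separated v Y ψ W q fun z => d (z + t) := by
  obtain ⟨es, h1, h2⟩ := h
  refine ⟨fun i z => es i (z + t), fun i => ⟨hY.shift_mem _ (h1 i).1 t, fun j => ?_⟩,
    fun i j hij => h2 i j fun z hz1 hz2 => ?_⟩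
  · ext x
    rw [aeval_row_shift, aeval_row_shift, (h1 i).2]
  · refine AgreeOnRows.eq_below hY hW (h1 i).1 (h1 j).1 (b := t.2) (fun z hz1 hz2 => ?_) z
      (by omega)
    have := hij (z - t) (by simp only [Prod.snd_sub]; omega) (by simp only [Prod.snd_sub]; omega)
    simpa using this

theorem separated_of_approx [TopologicalSpace A] [DiscreteTopology A] [Finite A]
    (hY : IsSubshift Y) (hv : Function.Injective v) (hψ : ψ ≠ 0) {d : ℤ × ℤ → A}
    (h : ∀ Q : Finset (ℤ × ℤ), ∃ c, (∀ z ∈ Q, c z = d z) ∧ Separated v Y ψ W q c) :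
    Separated v Y ψ W q d := by
  choose c hc es hes hsep using fun n : ℕ => h (Finset.Icc (-n, -n) (n, n))
  have hcd (z : ℤ × ℤ) : ∀ᶠ n in atTop, c n z = d z := by
    filter_upwards [eventually_ge_atTop (max z.1.natAbs z.2.natAbs)] with n hn
    refine hc n z ?_
    simp only [Finset.mem_Icc, Prod.le_def]
    omega
  obtain ⟨f, φ, hφ, hf, hlim⟩ := exists_limit hY.isClosed es fun n i => (hes n i).1
  have hrel (i : Fin q) (j : ℤ) :
      aeval seqShift ψ (row v d j) = aeval seqShift ψ (row v (f i) j) := by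
    ext x
    obtain ⟨n, h1, h2⟩ := (((Filter.eventually_all_finset (Finset.range (ψ.natDegree + 1))).2
      fun k _ => hφ.tendsto_atTop.eventually (hcd (x + k, j))).and
      ((Filter.eventually_all_finset (Finset.range (ψ.natDegree + 1))).2
      fun k _ => hlim i (x + k, j))).exists
    have h3 := congrFun ((hes (φ n) i).2 j) x
    rw [aeval_row_apply, aeval_row_apply] at h3 ⊢
    rw [Finset.sum_congr rfl fun k hk => by rw [← h1 k hk], h3]
    exact Finset.sum_congr rfl fun k hk => by rw [h2 k hk]
  refine ⟨f, fun i => ⟨hf i, hrel i⟩, fun i j hij => ?_⟩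
  obtain ⟨n, h1, h2⟩ := (((Filter.eventually_all_finset
      (Finset.Ico (0 : ℤ) ψ.natDegree ×ˢ Finset.Ico (0 : ℤ) W)).2 fun z _ => hlim i z).and
      ((Filter.eventually_all_finset _).2 fun z _ => hlim j z)).exists
  refine hsep (φ n) i j (agreeOnRows_of_eqOn_box hv hψ
    (fun y => ((hes (φ n) i).2 y).symm.trans ((hes (φ n) j).2 y)) fun z hz => ?_)
  rw [h1 z hz, h2 z hz]
  rw [Finset.mem_product, Finset.mem_Ico, Finset.mem_Ico] at hz
  exact hij z hz.2.1 (by omega)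

theorem agreeOnRows_cons {b : ℤ} {e : ℤ × ℤ → A} {es : Fin q → ℤ × ℤ → A}
    (he : ∀ i, ¬ AgreeOnRows b W e (es i)) (hes : ∀ i j, AgreeOnRows b W (es i) (es j) → i = j) :
    ∀ i j, AgreeOnRows b W ((Fin.cons e es : Fin (q + 1) → ℤ × ℤ → A) i)
      ((Fin.cons e es : Fin (q + 1) → ℤ × ℤ → A) j) → i = j := by
  intro i j
  refine Fin.cases ?_ (fun i => ?_) i <;> refine Fin.cases ?_ (fun j => ?_) j
  · simp
  · exact fun h => absurd h (he j)
  · exact fun h => absurd h.symm (he i)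
  · exact fun h => congrArg _ (hes i j h)

/-- In a subshift with dense orbits satisfying a row relation, nondeterminism upwards implies
nondeterminism downwards. -/
theorem downNondeterministic [TopologicalSpace A] [DiscreteTopology A] [Finite A]
    (hY : IsSubshift Y) (hdense : DenseOrbits Y) (hv : Function.Injective v) {w : ℕ}
    {G : ℕ → ℂ[X]} {κ : ℂ} (hrel : RowRelation v Y w ψ G κ) (hup : UpNondeterministic Y) :
    DownNondeterministic Y := by
  by_contra hdown
  obtain ⟨W, hW0, hW⟩ := exists_window hY hdown
  obtain ⟨d, hd, e, he, hde, x, hx⟩ := hup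
  have hde' (j : ℤ) : aeval seqShift ψ (row v d j) = aeval seqShift ψ (row v e j) := by
    rw [← sub_eq_zero, ← map_sub]
    exact hrel.aeval_sub_eq_zero hd he hde j
  obtain ⟨q, hq, hq'⟩ : ∃ q, (∃ c ∈ Y, Separated v Y ψ W q c) ∧
      ¬ ∃ c ∈ Y, Separated v Y ψ W (q + 1) c := by
    by_contra! h
    have hall (q : ℕ) : ∃ c ∈ Y, Separated v Y ψ W q c := by
      induction q with
      | zero => exact ⟨d, hd, Fin.elim0, fun i => i.elim0, fun i => i.elim0⟩
      | succ q ih => exact h q ih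
    obtain ⟨c, -, hc⟩ := hall (Nat.card
      ((Finset.Ico (0 : ℤ) ψ.natDegree ×ˢ Finset.Ico (0 : ℤ) W : Finset (ℤ × ℤ)) → A) + 1)
    exact absurd (hc.le_card hv hrel.ne_zero) (by omega)
  push Not at hq'
  have hall (c) (hc : c ∈ Y) : Separated v Y ψ W q c := by
    obtain ⟨c₀, hc₀, hsep⟩ := hq
    refine separated_of_approx hY hv hrel.ne_zero fun Q => ?_
    obtain ⟨t, ht, htQ⟩ := exists_upward_shift hY hdense hc hc₀ Q
    exact ⟨_, htQ, hsep.shift hY hW ht⟩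
  let s (c : ℤ × ℤ → A) : ℤ × ℤ → A := fun z => c (z + (0, -(W : ℤ)))
  have hs {c : ℤ × ℤ → A} (hc : c ∈ Y) : s c ∈ Y := hY.shift_mem c hc _
  have hsde (j : ℤ) : aeval seqShift ψ (row v (s d) j) = aeval seqShift ψ (row v (s e) j) := by
    ext x
    rw [aeval_row_shift, aeval_row_shift, hde']
  have hagree : AgreeOnRows 0 W (s d) (s e) :=
    fun z _ hz => hde _ (by simp only [Prod.snd_add]; omega)
  obtain ⟨es, h1, h2⟩ := hall _ (hs hd)
  obtain ⟨i, hi⟩ : ∃ i, AgreeOnRows 0 W (s d) (es i) := by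
    by_contra! h
    refine hq' _ (hs hd) ⟨Fin.cons (s d) es, Fin.forall_iff_succ.2 ⟨⟨hs hd, fun _ => rfl⟩, h1⟩,
      agreeOnRows_cons h h2⟩
  have hne : ∀ j ≠ i, ¬ AgreeOnRows 0 W (s d) (es j) :=
    fun j hj h => hj (h2 j i (h.symm.trans hi))
  let es' := Function.update es i (s d)
  have h1' (j) : es' j ∈ Y ∧
      ∀ y, aeval seqShift ψ (row v (s d) y) = aeval seqShift ψ (row v (es' j) y) := by
    by_cases hj : j = i
    · subst hj
      rw [show es' j = s d from Function.update_self ..]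
      exact ⟨hs hd, fun _ => rfl⟩
    · simp only [es', Function.update_of_ne hj]
      exact h1 j
  have hes' (j) : AgreeOnRows 0 W (es' j) (es j) := by
    by_cases hj : j = i
    · subst hj
      simpa only [es', Function.update_self] using hi
    · rw [show es' j = es j from Function.update_of_ne hj _ _]
      exact fun _ _ _ => rfl
  have hmove {c c' : ℤ × ℤ → A} (hc : c ∈ Y) (hc' : c' ∈ Y) (h : AgreeOnRows 1 W c c') :
      AgreeOnRows 0 W c c' := fun z _ hz => h.eq_below hY hW hc hc' z (by omega)
  have hsep : ∀ j k, AgreeOnRows 1 W ((Fin.cons (s e) es' : Fin (q + 1) → ℤ × ℤ → A) j)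
      ((Fin.cons (s e) es' : Fin (q + 1) → ℤ × ℤ → A) k) → j = k := by
    refine agreeOnRows_cons (fun j hj => ?_) fun j k hjk => h2 j k ?_
    · by_cases hji : j = i
      · subst hji
        simp only [es', Function.update_self] at hj
        have := hj (x, W) (by simp only; omega) (by simp only; omega)
        simp only [s, Prod.mk_add_mk, add_neg_cancel, add_zero] at this
        exact hx this.symm
      · exact hne j hji (hagree.trans ((hmove (hs he) (h1' j).1 hj).trans (hes' j)))
    · exact (hes' j).symm.trans ((hmove (h1' j).1 (h1' k).1 hjk).trans (hes' k))
  refine hq' _ (hY.shift_mem _ (hs hd) (0, 1)) ⟨fun j z =>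
    (Fin.cons (s e) es' : Fin (q + 1) → ℤ × ℤ → A) j (z + (0, 1)), fun j => ?_,
    fun j k hjk => hsep j k fun z hz1 hz2 => ?_⟩
  · have : (Fin.cons (s e) es' : Fin (q + 1) → ℤ × ℤ → A) j ∈ Y ∧ ∀ y,
        aeval seqShift ψ (row v (s d) y) =
        aeval seqShift ψ (row v ((Fin.cons (s e) es' : Fin (q + 1) → ℤ × ℤ → A) j) y) :=
      Fin.cases ⟨hs he, hsde⟩ h1' j
    refine ⟨hY.shift_mem _ this.1 _, fun y => ?_⟩
    ext x
    exact (aeval_row_shift v ψ (s d) _ _ _).trans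
      ((congrFun (this.2 _) _).trans (aeval_row_shift v ψ _ _ _ _).symm)
  · have := hjk (z - (0, 1)) (by simp only [Prod.snd_sub]; omega)
      (by simp only [Prod.snd_sub]; omega)
    simpa using this

end Determinism

section Balanced

variable {A : Type*} {Y : Set (ℤ × ℤ → A)}

/-- The horizontal segment of `ℓ` lattice points whose left end is `(x, b)`. -/
def segment (x b : ℤ) (ℓ : ℕ) : Finset (ℤ × ℤ) := (Finset.range ℓ).image fun i : ℕ => (x + i, b)

theorem mem_segment {x b : ℤ} {ℓ : ℕ} {z : ℤ × ℤ} :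
    z ∈ segment x b ℓ ↔ x ≤ z.1 ∧ z.1 < x + ℓ ∧ z.2 = b := by
  simp only [segment, Finset.mem_image, Finset.mem_range, Prod.ext_iff]
  constructor
  · rintro ⟨i, hi, h1, h2⟩
    omega
  · rintro ⟨h1, h2, h3⟩
    exact ⟨(z.1 - x).toNat, by omega, by omega, h3.symm⟩

theorem card_segment (x b : ℤ) (ℓ : ℕ) : (segment x b ℓ).card = ℓ := by
  rw [segment, Finset.card_image_of_injective _ fun i j h => by simpa using h, Finset.card_range]

theorem card_union_segment {D : Finset (ℤ × ℤ)} {b : ℤ} (hD : ∀ z ∈ D, z.2 ≠ b) (x : ℤ) (ℓ : ℕ) :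
    (D ∪ segment x b ℓ).card = D.card + ℓ := by
  rw [Finset.card_union_of_disjoint, card_segment]
  exact Finset.disjoint_left.2 fun z hz hz' => hD z hz (mem_segment.1 hz').2.2

/-- If a row added to a shape creates fewer new patterns than it has points, then agreement below
the row and on enough points of the row propagates to the right. -/
theorem eq_right_of_balanced [TopologicalSpace A] [Finite A] (hY : IsSubshift Y)
    {Dl : Finset (ℤ × ℤ)} {b x₀ : ℤ} {ℓ : ℕ} (hDl : ∀ z ∈ Dl, z.2 < b)
    (hbal : patternCount Y (Dl ∪ segment x₀ b ℓ) + 1 ≤ patternCount Y Dl + ℓ)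
    {d e : ℤ × ℤ → A} (hd : d ∈ Y) (he : e ∈ Y) (hde : ∀ z : ℤ × ℤ, z.2 < b → d z = e z)
    {x : ℤ} (hx : ∀ i : ℕ, i < ℓ → d (x + i, b) = e (x + i, b)) (i : ℕ) :
    d (x + i, b) = e (x + i, b) := by
  obtain ⟨j, hj, hle⟩ : ∃ j < ℓ, patternCount Y (Dl ∪ segment x₀ b (j + 1)) ≤
      patternCount Y (Dl ∪ segment x₀ b j) := by
    by_contra! h
    have (j : ℕ) (hj : j ≤ ℓ) : patternCount Y Dl + j ≤ patternCount Y (Dl ∪ segment x₀ b j) := by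
      induction j with
      | zero => exact patternCount_mono Finset.subset_union_left
      | succ j ih =>
        have := ih (by omega)
        have := h j (by omega)
        omega
    have := this ℓ le_rfl
    omega
  induction i using Nat.strong_induction_on with
  | _ i ih =>
    by_cases hi : i < ℓ
    · exact hx i hi
    · have := eqOn_of_patternCount_le (D := Dl ∪ segment x₀ b j) (D' := Dl ∪ segment x₀ b (j + 1))
        (Finset.union_subset_union_right fun z hz => by rw [mem_segment] at hz ⊢; omega) hle
        (hY.shift_mem d hd (x + i - j - x₀, 0)) (hY.shift_mem e he (x + i - j - x₀, 0))
        (fun z hz => ?_) (x₀ + j, b)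
        (Finset.mem_union_right _ (mem_segment.2 (by dsimp only; omega)))
      · convert this using 2 <;> ext <;> simp only [Prod.fst_add, Prod.snd_add] <;> omega
      · rcases Finset.mem_union.1 hz with hz | hz
        · exact hde _ (by have := hDl z hz; simp only [Prod.snd_add]; omega)
        · rw [mem_segment] at hz
          have := ih (z.1 - x₀ + i - j).toNat (by omega)
          convert this using 2 <;> ext <;> simp only [Prod.fst_add, Prod.snd_add] <;> omega

/-- The patterns of shape `D` in `Y` that extend to `D'` in several ways. -/
def badPatterns (Y : Set (ℤ × ℤ → A)) {D D' : Finset (ℤ × ℤ)} (h : D ⊆ D') : Set (D → A) :=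
  {p | ∃ x ∈ D'.restrict '' Y, ∃ y ∈ D'.restrict '' Y, Finset.restrict₂ (π := fun _ => A) h x = p ∧
    Finset.restrict₂ (π := fun _ => A) h y = p ∧ x ≠ y}

theorem exists_all_bad [TopologicalSpace A] [DiscreteTopology A] [Finite A] (hY : IsSubshift Y)
    {Dl : Finset (ℤ × ℤ)} {b x₀ : ℤ} {ℓ : ℕ} (hDl : ∀ z ∈ Dl, z.2 < b)
    (hbal : patternCount Y (Dl ∪ segment x₀ b ℓ) + 1 ≤ patternCount Y Dl + ℓ)
    (hup : UpNondeterministic Y) :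
    ∃ y ∈ Y, ∀ t : ℤ, Dl.restrict (fun z => y (z + (t, 0))) ∈
      badPatterns Y (Finset.subset_union_left : Dl ⊆ Dl ∪ segment x₀ b ℓ) := by
  obtain ⟨d, e, hd, he, hde, x₁, hx₁⟩ : ∃ d e, d ∈ Y ∧ e ∈ Y ∧
      (∀ z : ℤ × ℤ, z.2 < b → d z = e z) ∧ ∃ x, d (x, b) ≠ e (x, b) := by
    obtain ⟨d, hd, e, he, hde, x, hx⟩ := hup
    refine ⟨_, _, hY.shift_mem d hd (0, -b), hY.shift_mem e he (0, -b),
      fun z hz => hde _ (by simp only [Prod.snd_add]; omega), x, by simpa using hx⟩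
  have hbad (t : ℤ) (ht : x₀ + t ≤ x₁) : Dl.restrict (fun z => d (z + (t, 0))) ∈
      badPatterns Y (Finset.subset_union_left : Dl ⊆ Dl ∪ segment x₀ b ℓ) := by
    refine ⟨_, ⟨_, hY.shift_mem d hd (t, 0), rfl⟩, _, ⟨_, hY.shift_mem e he (t, 0), rfl⟩, rfl,
      (restrict_eq_restrict_iff (c := fun z => e (z + (t, 0)))).2 fun z hz =>
        (hde _ ?_).symm, fun h => hx₁ ?_⟩
    · have := hDl z hz
      simp only [Prod.snd_add]
      omega
    · rw [restrict_eq_restrict_iff] at h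
      have := eq_right_of_balanced hY hDl hbal hd he hde (x := x₀ + t) (fun i hi => ?_)
        (x₁ - (x₀ + t)).toNat
      · rwa [Int.toNat_of_nonneg (by omega), add_sub_cancel] at this
      · have := h (x₀ + i, b) (Finset.mem_union_right _ (mem_segment.2 (by dsimp only; omega)))
        simpa [add_right_comm] using this
  obtain ⟨y, φ, hφ, hy, hlim⟩ := exists_limit hY.isClosed
    (fun n (_ : Unit) z => d (z + (x₁ - x₀ - n, 0))) (fun n _ => hY.shift_mem d hd _)
  refine ⟨y (), hy (), fun t => ?_⟩
  obtain ⟨n, h1, hn⟩ := (((Filter.eventually_all_finset Dl).2 fun z _ => hlim () (z + (t, 0))).and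
      (hφ.tendsto_atTop.eventually_ge_atTop t.toNat)).exists
  rw [← restrict_eq_restrict_iff.2 h1]
  simp only [add_assoc, Prod.mk_add_mk, add_zero]
  exact hbad _ (by omega)

/-- A subshift that is nondeterministic upwards and of low complexity on a shape whose top row is
short relative to the other rows contains a horizontally periodic element. -/
theorem exists_horizontal_period_of_balanced [TopologicalSpace A] [DiscreteTopology A] [Finite A]
    (hY : IsSubshift Y) (hup : UpNondeterministic Y) {v : A → ℂ} (hv : Function.Injective v)
    {Dl : Finset (ℤ × ℤ)} {b x₀ : ℤ} {w ℓ : ℕ} (hDl : ∀ z ∈ Dl, b - w ≤ z.2 ∧ z.2 < b)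
    (hle : patternCount Y (Dl ∪ segment x₀ b ℓ) ≤ Dl.card + ℓ) (hlt : Dl.card < patternCount Y Dl)
    (hrows : ∀ j, b - w ≤ j → j < b → ∃ x : ℤ, ∀ i : ℕ, i + 1 < ℓ → (x + i, j) ∈ Dl) :
    ∃ y ∈ Y, ∃ k : ℕ, 0 < k ∧ ∀ x j, y (x + k, j) = y (x, j) := by
  have hbal : patternCount Y (Dl ∪ segment x₀ b ℓ) + 1 ≤ patternCount Y Dl + ℓ := by omega
  rw [← card_union_segment (fun z hz => (hDl z hz).2.ne) x₀ ℓ] at hle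
  obtain ⟨y, hy, hbad⟩ := exists_all_bad hY (fun z hz => (hDl z hz).2) hbal hup
  refine ⟨y, hy, ?_⟩
  obtain ⟨ψ, G, κ, hrel⟩ := exists_rowRelation hY ⟨y, hy⟩ v hle (y₀ := b - w) (w := w)
    (fun z hz => by
      rcases Finset.mem_union.1 hz with hz | hz
      · have := hDl z hz
        omega
      · rw [mem_segment] at hz
        omega)
  have hcard : (badPatterns Y (Finset.subset_union_left : Dl ⊆ Dl ∪ segment x₀ b ℓ)).ncard ≤
      ℓ - 1 := by
    have := ncard_image_add_ncard_nonunique_le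
      (Set.toFinite ((Dl ∪ segment x₀ b ℓ).restrict '' Y))
      (Finset.restrict₂ (π := fun _ => A) (Finset.subset_union_left : Dl ⊆ Dl ∪ segment x₀ b ℓ))
    rw [restrict₂_image] at this
    change patternCount Y Dl + (badPatterns Y _).ncard ≤ patternCount Y _ at this
    omega
  have hrows' (j : Fin w) : ∃ x : ℤ, ∀ i : Fin (ℓ - 1), (x + (i : ℕ), b - w + (j : ℕ)) ∈ Dl := by
    obtain ⟨x, hx⟩ := hrows (b - w + (j : ℕ)) (by omega) (by omega)
    exact ⟨x, fun i => hx i (by omega)⟩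
  choose xs hxs using hrows'
  let σ : ℤ → Fin w → A := fun x j => y (xs j + x, b - w + (j : ℕ))
  obtain ⟨k, hk, hper⟩ := exists_period_of_ncard_words_le σ (ℓ - 1) <| by
    refine (Set.ncard_le_ncard (t := (fun (p : Dl → A) i j => p ⟨_, hxs j i⟩) '' badPatterns Y
      (Finset.subset_union_left : Dl ⊆ Dl ∪ segment x₀ b ℓ)) ?_ (Set.toFinite _)).trans
      ((Set.ncard_image_le (Set.toFinite _)).trans hcard)
    rintro _ ⟨t, rfl⟩
    refine ⟨_, hbad t, ?_⟩
    ext i j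
    simp only [Finset.restrict, wordAt, σ, Prod.mk_add_mk, add_zero]
    congr 2
    ring
  refine hrel.exists_period hv hy b hk fun j h1 h2 x => ?_
  have := congrFun (hper (x - xs ⟨(j - (b - w)).toNat, by omega⟩)) ⟨(j - (b - w)).toNat, by omega⟩
  simp only [σ] at this
  rw [Int.toNat_of_nonneg (by omega)] at this
  convert this using 3 <;> ring

end Balanced

section Pull

variable {A : Type*} {Y : Set (ℤ × ℤ → A)} (T : ℤ × ℤ ≃+ ℤ × ℤ)

/-- The set of configurations obtained from `Y` by the change of coordinates `T`. -/
def pull (Y : Set (ℤ × ℤ → A)) : Set (ℤ × ℤ → A) := {c | c ∘ T.symm ∈ Y}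

theorem comp_mem_pull {c : ℤ × ℤ → A} (hc : c ∈ Y) : c ∘ T ∈ pull T Y := by
  simpa [pull, Function.comp_assoc] using hc

theorem IsSubshift.pull [TopologicalSpace A] (hY : IsSubshift Y) : IsSubshift (pull T Y) where
  isClosed := hY.isClosed.preimage (by fun_prop)
  shift_mem c hc t := by
    have := hY.shift_mem _ hc (T t)
    simpa [LowComplexity.pull, Function.comp_def] using this

theorem DenseOrbits.pull (hY : DenseOrbits Y) : DenseOrbits (pull T Y) := by
  classical
  intro d hd e he Q
  obtain ⟨t, ht⟩ := hY _ hd _ he (Q.image T)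
  refine ⟨T.symm t, fun z hz => ?_⟩
  simpa using ht (T z) (Finset.mem_image_of_mem _ hz)

theorem patternCount_pull_le [Finite A] {D D' : Finset (ℤ × ℤ)} (h : ∀ z ∈ D', T z ∈ D) :
    patternCount (pull T Y) D' ≤ patternCount Y D := by
  refine (Set.ncard_le_ncard (t := (fun (p : D → A) (z : D') => p ⟨T z, h z z.2⟩) ''
    (D.restrict '' Y)) ?_ (Set.toFinite _)).trans (Set.ncard_image_le (Set.toFinite _))
  rintro _ ⟨c, hc, rfl⟩
  refine ⟨_, ⟨_, hc, rfl⟩, ?_⟩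
  ext z
  simp

theorem pull_symm_pull : pull T.symm (pull T Y) = Y := by
  ext c
  simp [pull, Function.comp_assoc]

theorem le_patternCount_pull [Finite A] {D D' : Finset (ℤ × ℤ)} (h : ∀ z ∈ D, T.symm z ∈ D') :
    patternCount Y D ≤ patternCount (pull T Y) D' := by
  have := patternCount_pull_le (Y := pull T Y) T.symm h
  rwa [pull_symm_pull] at this

end Pull

section Polyhedral

/-- A set of lattice points cut out by linear inequalities. -/
def IsPolyhedral (D : Finset (ℤ × ℤ)) : Prop :=
  ∃ H : Set ((ℤ × ℤ →+ ℤ) × ℤ), ∀ z, z ∈ D ↔ ∀ h ∈ H, h.1 z ≤ h.2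

theorem addMonoidHom_apply (L : ℤ × ℤ →+ ℤ) (x y : ℤ) : L (x, y) = L (1, 0) * x + L (0, 1) * y := by
  have : ((x, y) : ℤ × ℤ) = x • (1, 0) + y • (0, 1) := by simp
  rw [this, map_add, map_zsmul, map_zsmul, smul_eq_mul, smul_eq_mul, mul_comm, mul_comm y]

variable {D : Finset (ℤ × ℤ)}

theorem IsPolyhedral.mem_of_between (hD : IsPolyhedral D) {x₁ x₂ x j : ℤ} (h₁ : (x₁, j) ∈ D)
    (h₂ : (x₂, j) ∈ D) (hx₁ : x₁ ≤ x) (hx₂ : x ≤ x₂) : (x, j) ∈ D := by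
  obtain ⟨H, hH⟩ := hD
  rw [hH] at *
  intro h hh
  have h₁ := h₁ h hh
  have h₂ := h₂ h hh
  rw [addMonoidHom_apply] at *
  rcases le_total 0 (h.1 (1, 0)) with hs | hs <;> nlinarith

theorem IsPolyhedral.mem_of_trapezoid (hD : IsPolyhedral D) {x₁ x₂ k l₁ l₂ x l : ℤ}
    (h₁ : (x₁, l₁) ∈ D) (h₁' : (x₁ + k, l₁) ∈ D) (h₂ : (x₂, l₂) ∈ D) (h₂' : (x₂ + k, l₂) ∈ D)
    (hlt : l₁ < l₂) (hl₁ : l₁ ≤ l) (hl₂ : l ≤ l₂)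
    (hx : (l₂ - l) * x₁ + (l - l₁) * x₂ ≤ (l₂ - l₁) * x)
    (hx' : (l₂ - l₁) * x ≤ (l₂ - l) * x₁ + (l - l₁) * x₂ + (l₂ - l₁) * k) : (x, l) ∈ D := by
  obtain ⟨H, hH⟩ := hD
  rw [hH] at *
  intro h hh
  have h₁ := h₁ h hh
  have h₂ := h₂ h hh
  have h₁' := h₁' h hh
  have h₂' := h₂' h hh
  rw [addMonoidHom_apply] at *
  generalize h.1 (1, 0) = α at *
  generalize h.1 (0, 1) = β at *
  refine le_of_mul_le_mul_left ?_ (sub_pos.2 hlt)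
  rcases le_total 0 α with hs | hs
  · have e1 := mul_le_mul_of_nonneg_left h₁' (sub_nonneg.2 hl₂)
    have e2 := mul_le_mul_of_nonneg_left h₂' (sub_nonneg.2 hl₁)
    have e3 := mul_le_mul_of_nonneg_left hx' hs
    linarith
  · have e1 := mul_le_mul_of_nonneg_left h₁ (sub_nonneg.2 hl₂)
    have e2 := mul_le_mul_of_nonneg_left h₂ (sub_nonneg.2 hl₁)
    have e3 := mul_le_mul_of_nonpos_left hx hs
    linarith

theorem IsPolyhedral.exists_consecutive (hD : IsPolyhedral D) {x₁ x₂ l₁ l₂ j : ℤ} {ℓ : ℕ}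
    (h₁ : segment x₁ l₁ ℓ ⊆ D) (h₂ : segment x₂ l₂ ℓ ⊆ D) (hlt : l₁ < l₂) (hj₁ : l₁ ≤ j)
    (hj₂ : j ≤ l₂) : ∃ x : ℤ, ∀ i : ℕ, i + 1 < ℓ → (x + i, j) ∈ D := by
  set N := l₂ - l₁ with hN
  have hN0 : 0 < N := by omega
  set M := (l₂ - j) * x₁ + (j - l₁) * x₂ with hM
  refine ⟨-(-M / N), fun i hi => ?_⟩
  have e1 := Int.mul_ediv_add_emod (-M) N
  have e2 := Int.emod_nonneg (-M) hN0.ne'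
  have e3 := Int.emod_lt_of_pos (-M) hN0
  have hmem {x l : ℤ} (h : segment x l ℓ ⊆ D) (k : ℕ) (hk : k < ℓ) : (x + k, l) ∈ D :=
    h (mem_segment.2 (by dsimp only; omega))
  refine hD.mem_of_trapezoid (k := (i + 1 : ℕ)) (by simpa using hmem h₁ 0 (by omega))
    (hmem h₁ _ hi) (by simpa using hmem h₂ 0 (by omega)) (hmem h₂ _ hi) hlt hj₁ hj₂ ?_ ?_
  · rw [← hM, ← hN]
    have : 0 ≤ N * (i : ℤ) := by positivity
    linarith
  · rw [← hM, ← hN]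
    push_cast
    linarith

theorem IsPolyhedral.exists_segment (hD : IsPolyhedral D) (j : ℤ) :
    ∃ (x : ℤ) (ℓ : ℕ), ∀ z, z ∈ segment x j ℓ ↔ z ∈ D ∧ z.2 = j := by
  classical
  let R := (D.filter fun z => z.2 = j).image Prod.fst
  have hR (x : ℤ) : x ∈ R ↔ (x, j) ∈ D := by simp [R]
  rcases R.eq_empty_or_nonempty with h | h
  · refine ⟨0, 0, fun z => ?_⟩
    have : ¬ (z ∈ D ∧ z.2 = j) := by
      rintro ⟨hz, rfl⟩
      have := (hR z.1).2 hz
      simp [h] at this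
    simp only [this, mem_segment, iff_false]
    omega
  · have h1 := R.min'_mem h
    have h2 := R.max'_mem h
    have h3 := R.min'_le_max' h
    refine ⟨R.min' h, (R.max' h + 1 - R.min' h).toNat, fun z => ?_⟩
    rw [mem_segment]
    constructor
    · rintro ⟨hz1, hz2, rfl⟩
      exact ⟨hD.mem_of_between ((hR _).1 h1) ((hR _).1 h2) hz1 (by omega), rfl⟩
    · rintro ⟨hz, rfl⟩
      have h4 := R.min'_le _ ((hR z.1).2 hz)
      have h5 := R.le_max' _ ((hR z.1).2 hz)
      omega

theorem IsPolyhedral.image (hD : IsPolyhedral D) (T : ℤ × ℤ ≃+ ℤ × ℤ) :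
    IsPolyhedral (D.image T) := by
  obtain ⟨H, hH⟩ := hD
  refine ⟨(fun h => (h.1.comp T.symm.toAddMonoidHom, h.2)) '' H, fun z => ?_⟩
  have : z ∈ D.image T ↔ T.symm z ∈ D := by
    rw [Finset.mem_image]
    exact ⟨by rintro ⟨y, hy, rfl⟩; simpa using hy, fun h => ⟨_, h, by simp⟩⟩
  rw [this, hH, Set.forall_mem_image]
  rfl

end Polyhedral

section Crossing

variable {A : Type*} {Y : Set (ℤ × ℤ → A)} {D : Finset (ℤ × ℤ)}

/-- The part of `D` lying in the rows `a, …, a + s - 1`. -/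
def strip (D : Finset (ℤ × ℤ)) (a : ℤ) (s : ℕ) : Finset (ℤ × ℤ) :=
  D.filter fun z => a ≤ z.2 ∧ z.2 < a + s

theorem mem_strip {a : ℤ} {s : ℕ} {z : ℤ × ℤ} :
    z ∈ strip D a s ↔ z ∈ D ∧ a ≤ z.2 ∧ z.2 < a + s := Finset.mem_filter

theorem exists_minimal_strip (hne : Y.Nonempty) (hle : patternCount Y D ≤ D.card) :
    ∃ (a : ℤ) (w : ℕ), patternCount Y (strip D a (w + 1)) ≤ (strip D a (w + 1)).card ∧
      ∀ a', (strip D a' w).card < patternCount Y (strip D a' w) := by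
  classical
  have hex : ∃ s : ℕ, ∃ a, patternCount Y (strip D a s) ≤ (strip D a s).card := by
    obtain ⟨lo, hlo⟩ := (D.image Prod.snd).bddBelow
    obtain ⟨hi, hhi⟩ := (D.image Prod.snd).bddAbove
    refine ⟨(hi + 1 - lo).toNat, lo, ?_⟩
    rwa [show strip D lo (hi + 1 - lo).toNat = D from Finset.filter_true_of_mem fun z hz => ?_]
    have h1 := hlo (Finset.mem_coe.2 (Finset.mem_image_of_mem Prod.snd hz))
    have h2 := hhi (Finset.mem_coe.2 (Finset.mem_image_of_mem Prod.snd hz))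
    omega
  obtain ⟨a, ha⟩ := Nat.find_spec hex
  have hmin := fun s => Nat.find_min (m := s) hex
  generalize Nat.find hex = s at ha hmin
  cases s with
  | zero =>
    have : strip D a 0 = ∅ := by
      ext z
      simp only [mem_strip, Finset.notMem_empty, iff_false]
      omega
    rw [this, patternCount_empty hne] at ha
    simp at ha
  | succ w =>
    refine ⟨a, w, ha, fun a' => ?_⟩
    have := hmin w w.lt_succ_self
    push Not at this
    exact this a'

/-- The reflection of the plane across the horizontal axis. -/
def reflection : ℤ × ℤ ≃+ ℤ × ℤ := (AddEquiv.refl ℤ).prodCongr (AddEquiv.neg ℤ)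

@[simp] theorem reflection_apply (z : ℤ × ℤ) : reflection z = (z.1, -z.2) := rfl

@[simp] theorem reflection_symm_apply (z : ℤ × ℤ) : reflection.symm z = (z.1, -z.2) := rfl

theorem DownNondeterministic.pull_reflection (h : DownNondeterministic Y) :
    UpNondeterministic (pull reflection Y) := by
  obtain ⟨d, hd, e, he, hde, x, hx⟩ := h
  exact ⟨_, comp_mem_pull _ hd, _, comp_mem_pull _ he,
    fun z hz => hde _ (by rw [reflection_apply]; dsimp only; omega), x, by simpa using hx⟩

/-- A subshift of low complexity on a polyhedral shape that is nondeterministic both upwards and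
downwards contains a horizontally periodic element. -/
theorem exists_horizontal_period [TopologicalSpace A] [DiscreteTopology A] [Finite A]
    (hY : IsSubshift Y) (hup : UpNondeterministic Y) (hdown : DownNondeterministic Y) {v : A → ℂ}
    (hv : Function.Injective v) (hD : IsPolyhedral D) (hle : patternCount Y D ≤ D.card) :
    ∃ y ∈ Y, ∃ k : ℕ, 0 < k ∧ ∀ x j, y (x + k, j) = y (x, j) := by
  obtain ⟨a, w, hle, hlt⟩ := exists_minimal_strip (hup.imp fun d hd => hd.1) hle
  obtain ⟨xa, ℓa, ha⟩ := hD.exists_segment a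
  obtain ⟨xb, ℓb, hb⟩ := hD.exists_segment (a + w)
  have hsa (ℓ : ℕ) (hℓ : ℓ ≤ ℓa) : segment xa a ℓ ⊆ D := fun z hz =>
    ((ha z).1 (by rw [mem_segment] at *; omega)).1
  have hsb (ℓ : ℕ) (hℓ : ℓ ≤ ℓb) : segment xb (a + w) ℓ ⊆ D := fun z hz =>
    ((hb z).1 (by rw [mem_segment] at *; omega)).1
  rcases le_total ℓb ℓa with h | h
  · have htop : strip D a (w + 1) = strip D a w ∪ segment xb (a + w) ℓb := by
      ext z
      rw [Finset.mem_union, hb, mem_strip, mem_strip]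
      grind
    rw [htop, card_union_segment fun z hz => by rw [mem_strip] at hz; omega] at hle
    refine exists_horizontal_period_of_balanced hY hup hv (w := w)
      (fun z hz => by rw [mem_strip] at hz; omega) hle (hlt a) fun j h1 h2 => ?_
    obtain ⟨x, hx⟩ := hD.exists_consecutive (hsa ℓb h) (hsb ℓb le_rfl) (by omega) (j := j)
      (by omega) (by omega)
    exact ⟨x, fun i hi => mem_strip.2 ⟨hx i hi, by dsimp only; omega⟩⟩
  · have hbot : strip D a (w + 1) = strip D (a + 1) w ∪ segment xa a ℓa := by
      ext z
      rw [Finset.mem_union, ha, mem_strip, mem_strip]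
      grind
    rw [hbot, card_union_segment fun z hz => by rw [mem_strip] at hz; omega] at hle
    have hcard : ((strip D (a + 1) w).image reflection).card = (strip D (a + 1) w).card :=
      Finset.card_image_of_injective _ reflection.injective
    have key := exists_horizontal_period_of_balanced (hY.pull reflection)
      hdown.pull_reflection hv (w := w) (Dl := (strip D (a + 1) w).image reflection)
      (b := -a) (x₀ := xa) (ℓ := ℓa) (fun z hz => ?_) ?_ ?_ fun j h1 h2 => ?_
    · obtain ⟨y, hy, k, hk, hper⟩ := key
      refine ⟨_, hy, k, hk, fun x j => ?_⟩
      simpa using hper x (-j)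
    · obtain ⟨z, hz', rfl⟩ := Finset.mem_image.1 hz
      rw [mem_strip] at hz'
      simp only [reflection_apply]
      omega
    · rw [hcard]
      refine (patternCount_pull_le _ fun z hz => ?_).trans hle
      rcases Finset.mem_union.1 hz with hz | hz
      · obtain ⟨z, hz', rfl⟩ := Finset.mem_image.1 hz
        simpa using Or.inl hz'
      · refine Finset.mem_union_right _ ?_
        rw [mem_segment] at *
        simp only [reflection_apply]
        omega
    · rw [hcard]
      exact (hlt _).trans_le (le_patternCount_pull _ fun z hz => Finset.mem_image_of_mem _ hz)
    · obtain ⟨x, hx⟩ := hD.exists_consecutive (hsa ℓa le_rfl) (hsb ℓa h) (by omega) (j := -j)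
        (by omega) (by omega)
      refine ⟨x, fun i hi => Finset.mem_image.2 ⟨_, mem_strip.2 ⟨hx i hi, ?_⟩, by simp⟩⟩
      dsimp only
      omega

end Crossing

section Minimal

variable {A : Type*} [TopologicalSpace A] [DiscreteTopology A] [Finite A] {X : Set (ℤ × ℤ → A)}

theorem exists_denseOrbits (hX : IsSubshift X) (hne : X.Nonempty) :
    ∃ Y ⊆ X, IsSubshift Y ∧ Y.Nonempty ∧ DenseOrbits Y := by
  obtain ⟨Y, hYX, hY⟩ : ∃ Y ⊆ X,
      Minimal (· ∈ {Y : Set (ℤ × ℤ → A) | IsSubshift Y ∧ Y.Nonempty}) Y := by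
    refine zorn_superset_nonempty {Y : Set (ℤ × ℤ → A) | IsSubshift Y ∧ Y.Nonempty} ?_ X ⟨hX, hne⟩
    intro C hC hchain hCne
    have := hCne.to_subtype
    refine ⟨⋂₀ C, ⟨⟨isClosed_sInter fun Z hZ => (hC hZ).1.isClosed,
      fun c hc t Z hZ => (hC hZ).1.shift_mem c (hc Z hZ) t⟩, ?_⟩,
      fun Z hZ => Set.sInter_subset_of_mem hZ⟩
    exact IsCompact.nonempty_sInter_of_directed_nonempty_isCompact_isClosed
      (show IsChain (· ⊇ ·) C from hchain.symm).directedOn (fun Z hZ => (hC hZ).2)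
      (fun Z hZ => (hC hZ).1.isClosed.isCompact) (fun Z hZ => (hC hZ).1.isClosed)
  refine ⟨Y, hYX, hY.prop.1, hY.prop.2, fun d hd e he Q => ?_⟩
  by_contra! h
  let Z : Set (ℤ × ℤ → A) := Y ∩ {c | ∀ t, ∃ z ∈ Q, c (z + t) ≠ d z}
  have hZ : IsSubshift Z := by
    refine ⟨hY.prop.1.isClosed.inter ?_, fun c hc t => ⟨hY.prop.1.shift_mem c hc.1 t, fun s => ?_⟩⟩
    · have : {c : ℤ × ℤ → A | ∀ t, ∃ z ∈ Q, c (z + t) ≠ d z} =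
          ⋂ t, ⋃ z ∈ Q, (fun c => c (z + t)) ⁻¹' {d z}ᶜ := by
        ext c
        simp
      rw [this]
      exact isClosed_iInter fun t => Q.finite_toSet.isClosed_biUnion fun z _ =>
        (isClosed_discrete _).preimage (continuous_apply _)
    · obtain ⟨z, hz, hne⟩ := hc.2 (s + t)
      exact ⟨z, hz, by rwa [← add_assoc] at hne⟩
  have := hY.le_of_le ⟨hZ, e, he, h⟩ Set.inter_subset_left hd
  obtain ⟨z, -, hz⟩ := this.2 0
  simp at hz

end Minimal

section HalfPlane

variable {A : Type*} {Y : Set (ℤ × ℤ → A)}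

theorem exists_disc_pair [Finite A] (hY : Y.Infinite) (N : ℕ) :
    ∃ d ∈ Y, ∃ e ∈ Y, ∃ p : ℤ × ℤ, d p ≠ e p ∧ (N : ℤ) ^ 2 ≤ p.1 ^ 2 + p.2 ^ 2 ∧
      ∀ z : ℤ × ℤ, z.1 ^ 2 + z.2 ^ 2 < p.1 ^ 2 + p.2 ^ 2 → d z = e z := by
  have := hY.to_subtype
  obtain ⟨⟨d, hd⟩, ⟨e, he⟩, hne, h⟩ := Finite.exists_ne_map_eq_of_infinite
    fun c : Y => (Finset.Icc ((-N, -N) : ℤ × ℤ) (N, N)).restrict c.1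
  rw [restrict_eq_restrict_iff] at h
  obtain ⟨p, hp, hmin⟩ := (measure fun z : ℤ × ℤ => (z.1 ^ 2 + z.2 ^ 2).toNat).wf.has_min
    {z | d z ≠ e z} (Function.ne_iff.1 fun h => hne (Subtype.ext h))
  refine ⟨d, hd, e, he, p, hp, ?_, fun z hz => ?_⟩
  · by_contra! hlt
    refine hp (h p ?_)
    have h1 := abs_le.1 <| abs_le_of_sq_le_sq (a := p.1) (b := N)
      (by nlinarith [sq_nonneg p.2]) (by omega)
    have h2 := abs_le.1 <| abs_le_of_sq_le_sq (a := p.2) (b := N)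
      (by nlinarith [sq_nonneg p.1]) (by omega)
    simp only [Finset.mem_Icc, Prod.le_def]
    exact ⟨⟨h1.1, h2.1⟩, h1.2, h2.2⟩
  · by_contra hdz
    refine hmin z hdz ?_
    have h1 : 0 ≤ z.1 ^ 2 + z.2 ^ 2 := by positivity
    change (z.1 ^ 2 + z.2 ^ 2).toNat < (p.1 ^ 2 + p.2 ^ 2).toNat
    generalize z.1 ^ 2 + z.2 ^ 2 = s at *
    generalize p.1 ^ 2 + p.2 ^ 2 = t at *
    omega

/-- An infinite subshift contains two configurations that agree on an open half plane but differ
at the origin. -/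
theorem exists_halfPlane_pair [TopologicalSpace A] [DiscreteTopology A] [Finite A]
    (hY : IsSubshift Y) (hinf : Y.Infinite) :
    ∃ u : ℝ × ℝ, u ≠ 0 ∧ ∃ d ∈ Y, ∃ e ∈ Y, d 0 ≠ e 0 ∧
      ∀ z : ℤ × ℤ, z.1 * u.1 + z.2 * u.2 < 0 → d z = e z := by
  choose d hd e he p hne hN hde using exists_disc_pair hinf
  let r (n : ℕ) : ℝ := √((p n).1 ^ 2 + (p n).2 ^ 2)
  have hr (n : ℕ) : r n ^ 2 = (p n).1 ^ 2 + (p n).2 ^ 2 := Real.sq_sqrt (by positivity)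
  have hrn (n : ℕ) : (n : ℝ) ≤ r n := Real.le_sqrt_of_sq_le (by exact_mod_cast hN n)
  let u (n : ℕ) : ℝ × ℝ := ((p (n + 1)).1 / r (n + 1), (p (n + 1)).2 / r (n + 1))
  have hrpos (n : ℕ) : 0 < r (n + 1) :=
    lt_of_lt_of_le (by positivity) (hrn (n + 1))
  have hu (n : ℕ) : (u n).1 ^ 2 + (u n).2 ^ 2 = 1 := by
    have := (hrpos n).ne'
    simp only [u]
    field_simp
    exact (hr _).symm
  have hcpt : IsCompact (Metric.closedBall (0 : ℝ × ℝ) 1) := isCompact_closedBall 0 1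
  obtain ⟨u', -, φ, hφ, hulim⟩ := hcpt.tendsto_subseq (x := u) fun n => by
    rw [mem_closedBall_zero_iff, Prod.norm_def, max_le_iff, Real.norm_eq_abs, Real.norm_eq_abs,
      ← sq_le_one_iff_abs_le_one, ← sq_le_one_iff_abs_le_one]
    constructor <;> nlinarith [hu n, sq_nonneg (u n).1, sq_nonneg (u n).2]
  have hu1 := (continuous_fst.tendsto u').comp hulim
  have hu2 := (continuous_snd.tendsto u').comp hulim
  have hu' : u'.1 ^ 2 + u'.2 ^ 2 = 1 :=
    tendsto_nhds_unique ((hu1.pow 2).add (hu2.pow 2)) (by simp [hu])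
  obtain ⟨f, φ', hφ', hf, hlim⟩ := exists_limit hY.isClosed
    (fun n (i : Bool) z => (if i then d (φ n + 1) else e (φ n + 1)) (z + p (φ n + 1)))
    (fun n i => by cases i <;> simp [hY.shift_mem, hd, he])
  refine ⟨u', ?_, f true, hf _, f false, hf _, fun h0 => ?_, fun z hz => ?_⟩
  · rintro rfl
    simp at hu'
  · obtain ⟨n, h1, h2⟩ := ((hlim true 0).and (hlim false 0)).exists
    refine hne (φ (φ' n) + 1) ?_
    simpa using h1.trans (h0.trans h2.symm)
  · have hdot : Tendsto (fun n => z.1 * (u (φ (φ' n))).1 + z.2 * (u (φ (φ' n))).2) atTop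
        (𝓝 (z.1 * u'.1 + z.2 * u'.2)) :=
      ((hu1.const_mul _).add (hu2.const_mul _)).comp hφ'.tendsto_atTop
    set s : ℝ := z.1 * u'.1 + z.2 * u'.2
    obtain ⟨M, hM⟩ := exists_nat_gt (((z.1 : ℝ) ^ 2 + z.2 ^ 2) / (-s))
    obtain ⟨n, h1, h2, h3, hn⟩ := ((hlim true z).and ((hlim false z).and
      ((hdot.eventually (gt_mem_nhds (show s < s / 2 by linarith))).and
      ((hφ.tendsto_atTop.comp hφ'.tendsto_atTop).eventually_ge_atTop M)))).exists
    rw [← h1, ← h2]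
    refine hde (φ (φ' n) + 1) _ ?_
    simp only [Function.comp_apply] at hn
    generalize φ (φ' n) = m at *
    have h4 : (z.1 : ℝ) ^ 2 + z.2 ^ 2 < r (m + 1) * -s := by
      rw [div_lt_iff₀ (by linarith)] at hM
      have h5 : (M : ℝ) ≤ r (m + 1) :=
        le_trans (by exact_mod_cast hn.trans m.le_succ) (hrn (m + 1))
      nlinarith
    have h5 : z.1 * ((p (m + 1)).1 : ℝ) + z.2 * (p (m + 1)).2 < r (m + 1) * (s / 2) := by
      have h6 := mul_lt_mul_of_pos_left h3 (hrpos m)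
      have := (hrpos m).ne'
      rwa [show r (m + 1) * (z.1 * (u m).1 + z.2 * (u m).2) =
        z.1 * ((p (m + 1)).1 : ℝ) + z.2 * (p (m + 1)).2 by simp only [u]; field_simp] at h6
    have h6 : ((z.1 + (p (m + 1)).1 : ℤ) : ℝ) ^ 2 + ((z.2 + (p (m + 1)).2 : ℤ) : ℝ) ^ 2 <
        ((p (m + 1)).1 : ℝ) ^ 2 + ((p (m + 1)).2 : ℝ) ^ 2 := by
      push_cast
      nlinarith
    exact_mod_cast h6

/-- Low complexity forces such a half plane to have a rational direction. -/
theorem exists_orthogonal [TopologicalSpace A] [Finite A] (hY : IsSubshift Y)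
    {D : Finset (ℤ × ℤ)} (hle : patternCount Y D ≤ D.card) {u : ℝ × ℝ} {d e : ℤ × ℤ → A}
    (hd : d ∈ Y) (he : e ∈ Y) (h0 : d 0 ≠ e 0)
    (hde : ∀ z : ℤ × ℤ, z.1 * u.1 + z.2 * u.2 < 0 → d z = e z) :
    ∃ t : ℤ × ℤ, t ≠ 0 ∧ t.1 * u.1 + t.2 * u.2 = 0 := by
  classical
  obtain ⟨v, hv⟩ : ∃ v : A → ℂ, Function.Injective v :=
    ⟨fun a => (Finite.equivFin A a : ℕ), fun a b h => by simpa [Fin.val_inj] using h⟩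
  obtain ⟨a, κ, ⟨z₁, hz₁, ha₁⟩, hrel⟩ := exists_affine_relation ⟨d, hd⟩ v hle
  obtain ⟨z₀, hz₀, hmax⟩ := (D.filter fun z => a z ≠ 0).exists_max_image
    (fun z => z.1 * u.1 + z.2 * u.2) ⟨z₁, Finset.mem_filter.2 ⟨hz₁, ha₁⟩⟩
  rw [Finset.mem_filter] at hz₀
  by_contra! h
  have hsub := (hrel _ (hY.shift_mem d hd (-z₀))).trans (hrel _ (hY.shift_mem e he (-z₀))).symm
  rw [← sub_eq_zero, ← Finset.sum_sub_distrib, Finset.sum_eq_single_of_mem z₀ hz₀.1] at hsub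
  · rw [← mul_sub, mul_eq_zero, add_neg_cancel, sub_eq_zero] at hsub
    exact hsub.elim hz₀.2 fun h => h0 (hv h)
  · intro z hz hne
    by_cases haz : a z = 0
    · simp [haz]
    · have h1 := hmax z (Finset.mem_filter.2 ⟨hz, haz⟩)
      have h2 := h (z - z₀) (sub_ne_zero.2 hne)
      rw [← sub_eq_add_neg, hde (z - z₀), sub_self]
      refine lt_of_le_of_ne ?_ h2
      simp only [Prod.fst_sub, Prod.snd_sub]
      push_cast
      linarith

/-- The unimodular change of coordinates with matrix `(p, -b; q, a)`. -/
def unimodular {p q a b : ℤ} (h : p * a + q * b = 1) : ℤ × ℤ ≃+ ℤ × ℤ where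
  toFun z := (p * z.1 - b * z.2, q * z.1 + a * z.2)
  invFun z := (a * z.1 + b * z.2, p * z.2 - q * z.1)
  left_inv z := by
    ext
    · linear_combination z.1 * h
    · linear_combination z.2 * h
  right_inv z := by
    ext
    · linear_combination z.1 * h
    · linear_combination z.2 * h
  map_add' x y := by
    ext <;> simp only [Prod.fst_add, Prod.snd_add] <;> ring

theorem exists_unimodular {u : ℝ × ℝ} (hu : u ≠ 0) {t : ℤ × ℤ} (ht : t ≠ 0)
    (htu : t.1 * u.1 + t.2 * u.2 = 0) :
    ∃ T : ℤ × ℤ ≃+ ℤ × ℤ, ∃ s : ℝ, 0 < s ∧ ∀ z, (T z).1 * u.1 + (T z).2 * u.2 = s * z.2 := by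
  have hg : Int.gcd t.1 t.2 ≠ 0 := fun h => ht (Prod.ext (Int.gcd_eq_zero_iff.1 h).1
    (Int.gcd_eq_zero_iff.1 h).2)
  obtain ⟨p, hp⟩ := Int.gcd_dvd_left t.1 t.2
  obtain ⟨q, hq⟩ := Int.gcd_dvd_right t.1 t.2
  have hbez := Int.gcd_eq_gcd_ab t.1 t.2
  generalize Int.gcdA t.1 t.2 = a at hbez
  generalize Int.gcdB t.1 t.2 = b at hbez
  generalize Int.gcd t.1 t.2 = g at *
  have hpq : p * a + q * b = 1 := by
    refine mul_left_cancel₀ (Nat.cast_ne_zero.2 hg : (g : ℤ) ≠ 0) ?_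
    rw [hp, hq] at hbez
    linear_combination -hbez
  have hpqu : p * u.1 + q * u.2 = 0 := by
    refine mul_left_cancel₀ (Nat.cast_ne_zero.2 hg : (g : ℝ) ≠ 0) ?_
    rw [hp, hq] at htu
    push_cast at htu
    linear_combination htu
  have hpqR : (p : ℝ) * a + q * b = 1 := by exact_mod_cast hpq
  have hs : a * u.2 - b * u.1 ≠ 0 := fun hs => hu <| by
    ext
    · simp only [Prod.fst_zero]
      linear_combination a * hpqu - q * hs - u.1 * hpqR
    · simp only [Prod.snd_zero]
      linear_combination b * hpqu + p * hs - u.2 * hpqR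
  rcases lt_or_gt_of_ne hs with hs | hs
  · refine ⟨unimodular (p := -p) (q := -q) (a := -a) (b := -b) (by linarith),
      -(a * u.2 - b * u.1), by linarith, fun z => ?_⟩
    simp only [unimodular, AddEquiv.coe_mk, Equiv.coe_fn_mk]
    push_cast
    linear_combination -z.1 * hpqu
  · refine ⟨unimodular hpq, a * u.2 - b * u.1, hs, fun z => ?_⟩
    simp only [unimodular, AddEquiv.coe_mk, Equiv.coe_fn_mk]
    push_cast
    linear_combination z.1 * hpqu

/-- After a change of coordinates, an infinite subshift of low complexity is nondeterministic
upwards. -/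
theorem exists_pull_upNondeterministic [TopologicalSpace A] [DiscreteTopology A] [Finite A]
    (hY : IsSubshift Y) (hinf : Y.Infinite) {D : Finset (ℤ × ℤ)}
    (hle : patternCount Y D ≤ D.card) :
    ∃ T : ℤ × ℤ ≃+ ℤ × ℤ, UpNondeterministic (pull T Y) := by
  obtain ⟨u, hu, d, hd, e, he, h0, hde⟩ := exists_halfPlane_pair hY hinf
  obtain ⟨t, ht, htu⟩ := exists_orthogonal hY hle hd he h0 hde
  obtain ⟨T, s, hs, hT⟩ := exists_unimodular hu ht htu
  refine ⟨T, _, comp_mem_pull T hd, _, comp_mem_pull T he, fun z hz => hde _ ?_, 0, ?_⟩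
  · rw [hT]
    exact mul_neg_of_pos_of_neg hs (by exact_mod_cast hz)
  · change d (T 0) ≠ e (T 0)
    rwa [map_zero]

end HalfPlane

section Main

variable {A : Type*} [TopologicalSpace A] {X Y : Set (ℤ × ℤ → A)}

theorem exists_period_of_finite (hY : IsSubshift Y) (hfin : Y.Finite) {c : ℤ × ℤ → A}
    (hc : c ∈ Y) : ∃ t : ℤ × ℤ, t ≠ 0 ∧ ∀ z, c (z + t) = c z := by
  have := hfin.to_subtype
  obtain ⟨i, j, hne, h⟩ := Finite.exists_ne_map_eq_of_infinite
    fun i : ℤ => (⟨_, hY.shift_mem c hc (i, 0)⟩ : Y)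
  refine ⟨(i - j, 0), by simpa [Prod.ext_iff, sub_eq_zero] using hne, fun z => ?_⟩
  have := congrFun (Subtype.ext_iff.1 h) (z - (j, 0))
  simp only [sub_add_cancel] at this
  rw [← this]
  congr 1
  ext <;> simp
  ring

/-- A nonempty subshift of low complexity on a polyhedral shape contains a periodic element. -/
theorem exists_period_of_patternCount_le [DiscreteTopology A] [Finite A] (hX : IsSubshift X)
    (hne : X.Nonempty) {D : Finset (ℤ × ℤ)} (hD : IsPolyhedral D) (hle : patternCount X D ≤ D.card) :
    ∃ c ∈ X, ∃ t : ℤ × ℤ, t ≠ 0 ∧ ∀ z, c (z + t) = c z := by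
  classical
  obtain ⟨Y, hYX, hY, hYne, hdense⟩ := exists_denseOrbits hX hne
  replace hle : patternCount Y D ≤ D.card :=
    (Set.ncard_le_ncard (Set.image_mono hYX) (Set.toFinite _)).trans hle
  by_cases hfin : Y.Finite
  · obtain ⟨c, hc⟩ := hYne
    exact ⟨c, hYX hc, exists_period_of_finite hY hfin hc⟩
  obtain ⟨T, hup⟩ := exists_pull_upNondeterministic hY hfin hle
  obtain ⟨v, hv⟩ : ∃ v : A → ℂ, Function.Injective v :=
    ⟨fun a => (Finite.equivFin A a : ℕ), fun a b h => by simpa [Fin.val_inj] using h⟩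
  have hle' : patternCount (pull T Y) (D.image T.symm) ≤ (D.image T.symm).card := by
    rw [Finset.card_image_of_injective _ T.symm.injective]
    refine (patternCount_pull_le T fun z hz => ?_).trans hle
    obtain ⟨z, hz', rfl⟩ := Finset.mem_image.1 hz
    simpa using hz'
  obtain ⟨lo, hlo⟩ := ((D.image T.symm).image Prod.snd).bddBelow
  obtain ⟨hi, hhi⟩ := ((D.image T.symm).image Prod.snd).bddAbove
  obtain ⟨ψ, G, κ, hrel⟩ := exists_rowRelation (hY.pull T) (hup.imp fun d hd => hd.1) v hle'
    (y₀ := lo) (w := (hi - lo).toNat) fun z hz => by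
      have h1 := hlo (Finset.mem_coe.2 (Finset.mem_image_of_mem Prod.snd hz))
      have h2 := hhi (Finset.mem_coe.2 (Finset.mem_image_of_mem Prod.snd hz))
      omega
  obtain ⟨y, hy, k, hk, hper⟩ := exists_horizontal_period (hY.pull T) hup
    (downNondeterministic (hY.pull T) (hdense.pull T) hv hrel hup) hv (hD.image T.symm) hle'
  refine ⟨_, hYX hy, T (k, 0), ?_, fun z => ?_⟩
  · simpa [Prod.ext_iff] using hk.ne'
  · have := hper (T.symm z).1 (T.symm z).2
    rw [Function.comp_apply, map_add, T.symm_apply_apply, Prod.add_def, add_zero]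
    exact this

end Main

theorem isPolyhedral_box (n m : ℕ) :
    IsPolyhedral (Finset.Icc (1 : ℤ) n ×ˢ Finset.Icc (1 : ℤ) m) := by
  refine ⟨{(-AddMonoidHom.fst ℤ ℤ, -1), (AddMonoidHom.fst ℤ ℤ, (n : ℤ)),
    (-AddMonoidHom.snd ℤ ℤ, -1), (AddMonoidHom.snd ℤ ℤ, (m : ℤ))}, fun z => ?_⟩
  simp [and_assoc]

end LowComplexity

/-- If `P` is a set of at most `n·m` patterns of shape
`D = {1,…,n} × {1,…,m}` and some configuration has all its `D`-patterns in `P`,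
then some periodic configuration has all its `D`-patterns in `P`. -/
theorem exists_periodic_of_low_complexity_SFT
    {A : Type*} [Fintype A] (n m : ℕ) (hn : 1 ≤ n) (hm : 1 ≤ m)
    (P : Set ((rect n m) → A)) (hP : P.ncard ≤ n * m)
    (c : ℤ × ℤ → A) (hc : patterns c (rect n m) ⊆ P) :
    ∃ c' : ℤ × ℤ → A, patterns c' (rect n m) ⊆ P ∧ Periodic c' := by
  classical
  let _ : TopologicalSpace A := ⊥
  have : DiscreteTopology A := ⟨rfl⟩
  let R : Finset (ℤ × ℤ) := Finset.Icc (1 : ℤ) n ×ˢ Finset.Icc (1 : ℤ) m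
  have hR : ∀ z, z ∈ R ↔ z ∈ rect n m := fun z => by
    simp only [R, Finset.mem_product, Finset.mem_Icc, rect, Set.mem_ofPred_eq]
    tauto
  have : Finite (rect n m) := (R.finite_toSet.subset fun z hz => (hR z).2 hz).to_subtype
  let X : Set (ℤ × ℤ → A) := {c | patterns c (rect n m) ⊆ P}
  have hX : LowComplexity.IsSubshift X := by
    refine ⟨?_, fun c hc t p ⟨s, hs⟩ => hc ⟨s - t, fun x => ?_⟩⟩
    · have : X = ⋂ t : ℤ × ℤ, (fun c (x : rect n m) => c (x - t)) ⁻¹' P := by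
        ext c
        rw [Set.mem_iInter]
        refine ⟨fun hc t => hc ⟨t, fun x => rfl⟩, fun hc p ⟨t, ht⟩ => ?_⟩
        rw [show p = fun x : rect n m => c (x - t) from funext ht]
        exact hc t
      rw [this]
      exact isClosed_iInter fun t => (isClosed_discrete P).preimage
        (continuous_pi fun x => continuous_apply _)
    · rw [hs x, Translate, Translate, sub_sub_eq_add_sub, sub_add_eq_add_sub]
  have hcount : LowComplexity.patternCount X R ≤ R.card := by
    have hsub : (R.restrict : (ℤ × ℤ → A) → R → A) '' X ⊆
        (fun (p : rect n m → A) (z : R) => p ⟨z, (hR z).1 z.2⟩) '' P := by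
      rintro _ ⟨c, hc, rfl⟩
      exact ⟨fun x => c x, hc ⟨0, fun x => by simp [Translate]⟩, rfl⟩
    calc LowComplexity.patternCount X R ≤ _ := Set.ncard_le_ncard hsub (Set.toFinite _)
      _ ≤ P.ncard := Set.ncard_image_le P.toFinite
      _ ≤ n * m := hP
      _ = R.card := by simp [R]
  obtain ⟨d, hd, t, ht, hper⟩ := LowComplexity.exists_period_of_patternCount_le hX ⟨c, hc⟩
    (LowComplexity.isPolyhedral_box n m) hcount
  refine ⟨d, hd, t, ht, funext fun z => ?_⟩
  rw [Translate, ← hper, sub_add_cancel]
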